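/- Let (W,S) be a finite Coxeter system. For every integer k ≥ 1, the number of strict k-chains u₁ < u₂ < … < u_k in the shard order ≤_σ on W equals the number of strict k-chains in the BHZ order ≤_β on W. (Equivalently, the f-vectors of the order complexes of the two posets coincide.) -/

import Mathlib

open scoped Classical

namespace ShardBHZ

variable {B : Type*} {W : Type*} [Group W] {M : CoxeterMatrix B} (cs : CoxeterSystem M W)

/-- The support `S(w)` of `w`: the set of simple reflections appearing in some
(equivalently, any) reduced word for `w`. -/
def supp (w : W) : Set B := {i | ∃ l : List B, cs.IsReduced l ∧ cs.wordProd l = w ∧ i ∈ l}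

/-- The standard parabolic subgroup `W_I` generated by the simple reflections in `I`. -/
def parab (I : Set B) : Subgroup W := Subgroup.closure (cs.simple '' I)

/-- `x` has no right descent in `I`; this characterizes the minimal length coset
representatives `W^I` of `W / W_I`. -/
def IsMinRep (I : Set B) (x : W) : Prop := ∀ i ∈ I, ¬ cs.IsRightDescent x i

/-- The BHZ order: `u ≤_β v` iff the parabolic component `v_{S(u)}` equals `u`, i.e.
`v = (v * u⁻¹) * u` is the parabolic factorization of `v` with respect to `W_{S(u)}`:
`u ∈ W_{S(u)}`, `v * u⁻¹` has no right descent in `S(u)`, and lengths add. -/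
def bhzLE (u v : W) : Prop :=
  u ∈ parab cs (supp cs u) ∧ IsMinRep cs (supp cs u) (v * u⁻¹) ∧
    cs.length v = cs.length (v * u⁻¹) + cs.length u

/-- The set `N(w)` of left inversions of `w`. -/
def invSet (w : W) : Set W := {t | cs.IsLeftInversion w t}

/-- The subgroup `G(w)` generated by `w * s * w⁻¹` for `s` a right descent of `w`. -/
def descConj (w : W) : Subgroup W :=
  Subgroup.closure {x | ∃ i, cs.IsRightDescent w i ∧ x = w * cs.simple i * w⁻¹}

/-- The shard intersection order: `u ≤_σ v` iff `N(u) ⊆ N(v)` and `G(u) ⊆ G(v)`. -/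
def shardLE (u v : W) : Prop := invSet cs u ⊆ invSet cs v ∧ descConj cs u ≤ descConj cs v

/-! ### The reflection cocycle and strong exchange -/

section Cocycle

/-- The action of a simple reflection on `W × ZMod 2` by conjugation on the first factor, flipping
the sign at the simple reflection itself. -/
noncomputable def signedConj (i : B) : Function.End (W × ZMod 2) := fun p =>
  (cs.simple i * p.1 * cs.simple i, p.2 + if p.1 = cs.simple i then 1 else 0)

theorem signedConj_mul_pow_apply (i j : B) (n : ℕ) (t : W) (ε : ZMod 2) :
    ((signedConj cs i * signedConj cs j) ^ n) (t, ε) =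
      (((cs.simple i * cs.simple j) ^ n) * t * ((cs.simple i * cs.simple j) ^ n)⁻¹,
        ε + ∑ k ∈ Finset.range (2 * n),
          if t = (cs.simple j * cs.simple i) ^ k * cs.simple j then 1 else 0) := by
  induction n generalizing t ε with
  | zero => simp; rfl
  | succ n ih =>
    rw [pow_succ]
    change ((signedConj cs i * signedConj cs j) ^ n)
      (signedConj cs i (signedConj cs j (t, ε))) = _
    simp only [signedConj]
    rw [ih]
    refine Prod.ext ?_ ?_
    · simp only [pow_succ, mul_inv_rev, cs.inv_simple, mul_assoc]
    · have h2 : 2 * (n + 1) = 2 * n + 1 + 1 := by ring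
      dsimp only
      rw [h2, Finset.sum_range_succ', Finset.sum_range_succ']
      have e0 : (t = (cs.simple j * cs.simple i) ^ 0 * cs.simple j) ↔ t = cs.simple j := by simp
      have e1 : (t = (cs.simple j * cs.simple i) ^ (0 + 1) * cs.simple j) ↔
          cs.simple j * t * cs.simple j = cs.simple i := by
        constructor
        · rintro rfl; simp [mul_assoc]
        · intro h; rw [← h]; simp [mul_assoc]
      have e2 : ∀ k, (t = (cs.simple j * cs.simple i) ^ (k + 1 + 1) * cs.simple j) ↔
          cs.simple i * (cs.simple j * t * cs.simple j) * cs.simple i =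
            (cs.simple j * cs.simple i) ^ k * cs.simple j := by
        intro k
        constructor
        · rintro rfl
          rw [pow_succ, pow_succ']
          have : ((cs.simple j * cs.simple i) * (cs.simple j * cs.simple i) ^ k) =
            (cs.simple j * cs.simple i) ^ k * (cs.simple j * cs.simple i) := by
              rw [← pow_succ, ← pow_succ']
          simp [mul_assoc]
        · intro h
          have : t = cs.simple j * cs.simple i *
            (cs.simple i * (cs.simple j * t * cs.simple j) * cs.simple i) *
              (cs.simple i * cs.simple j) := by simp [mul_assoc]
          rw [this, h, pow_succ, pow_succ']
          have h3 : ((cs.simple j * cs.simple i) * (cs.simple j * cs.simple i) ^ k) =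
            (cs.simple j * cs.simple i) ^ k * (cs.simple j * cs.simple i) := by
              rw [← pow_succ, ← pow_succ']
          simp [mul_assoc]
      rw [Finset.sum_congr rfl (fun k _ => if_congr (e2 k) rfl rfl), if_congr e0 rfl rfl,
        if_congr e1 rfl rfl, ← add_assoc, ← add_assoc]
      have key : ∀ e a b c : ZMod 2, e + a + b + c = e + c + b + a := by decide
      exact key _ _ _ _

theorem signedConj_isLiftable : M.IsLiftable (signedConj cs) := by
  intro i j
  funext p
  obtain ⟨t, ε⟩ := p
  rw [signedConj_mul_pow_apply, cs.simple_mul_simple_pow, two_mul, Finset.sum_range_add]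
  have h : ∀ k, (cs.simple j * cs.simple i) ^ (M i j + k) = (cs.simple j * cs.simple i) ^ k := by
    intro k
    rw [pow_add, cs.simple_mul_simple_pow', one_mul]
  simp only [h, CharTwo.add_self_eq_zero]
  simp
  rfl

/-- The action of `W` on `W × ZMod 2` extending `signedConj`. -/
noncomputable def signedAction : W →* Function.End (W × ZMod 2) :=
  cs.lift ⟨signedConj cs, signedConj_isLiftable cs⟩

theorem signedAction_wordProd (ω : List B) (t : W) (ε : ZMod 2) :
    signedAction cs (cs.wordProd ω) (t, ε) =
      (cs.wordProd ω * t * (cs.wordProd ω)⁻¹, ε + (cs.rightInvSeq ω).count t) := by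
  induction ω with
  | nil => simp; rfl
  | cons i ω ih =>
    rw [cs.wordProd_cons, map_mul]
    change signedAction cs (cs.simple i) (signedAction cs (cs.wordProd ω) (t, ε)) = _
    rw [ih, signedAction, cs.lift_apply_simple]
    simp only [signedConj, CoxeterSystem.rightInvSeq, List.count_cons]
    refine Prod.ext ?_ ?_
    · simp [mul_assoc]
    · have : (cs.wordProd ω * t * (cs.wordProd ω)⁻¹ = cs.simple i) ↔
          ((cs.wordProd ω)⁻¹ * cs.simple i * cs.wordProd ω = t) := by
        constructor
        · intro h; rw [← h]; group
        · rintro rfl; group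
      simp only [this, beq_iff_eq]
      push_cast
      ring

/-- The sign cocycle of `W`. -/
noncomputable def eta (w t : W) : ZMod 2 := (signedAction cs w (t, 0)).2

theorem eta_wordProd (ω : List B) (t : W) :
    eta cs (cs.wordProd ω) t = (cs.rightInvSeq ω).count t := by
  simp [eta, signedAction_wordProd]

theorem signedAction_apply (w t : W) (ε : ZMod 2) :
    signedAction cs w (t, ε) = (w * t * w⁻¹, ε + eta cs w t) := by
  obtain ⟨ω, rfl⟩ := cs.wordProd_surjective w
  rw [signedAction_wordProd, eta_wordProd]

theorem eta_mul (u v t : W) : eta cs (u * v) t = eta cs v t + eta cs u (v * t * v⁻¹) := by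
  have : signedAction cs (u * v) (t, 0) = signedAction cs u (signedAction cs v (t, 0)) := by
    rw [map_mul]; rfl
  rw [signedAction_apply, signedAction_apply, signedAction_apply] at this
  simpa using congrArg Prod.snd this

theorem eta_one (t : W) : eta cs 1 t = 0 := by
  simpa using eta_wordProd cs [] t

theorem eta_simple (i : B) (t : W) : eta cs (cs.simple i) t = if cs.simple i = t then 1 else 0 := by
  have := eta_wordProd cs [i] t
  simp only [cs.wordProd_singleton, cs.rightInvSeq_singleton, List.count_cons] at this
  rw [this]
  simp

theorem eta_inv (u t : W) : eta cs u⁻¹ (u * t * u⁻¹) = eta cs u t := by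
  have h := eta_mul cs u⁻¹ u t
  rw [inv_mul_cancel, eta_one] at h
  exact (CharTwo.add_eq_zero.mp h.symm).symm

theorem eta_self {t : W} (ht : cs.IsReflection t) : eta cs t t = 1 := by
  obtain ⟨w, i, rfl⟩ := ht
  rw [eta_mul]
  have h1 : w⁻¹ * (w * cs.simple i * w⁻¹) * w⁻¹⁻¹ = cs.simple i := by group
  rw [h1, eta_mul, eta_simple]
  have h2 : cs.simple i * cs.simple i * (cs.simple i)⁻¹ = cs.simple i := by simp
  rw [h2, eta_inv]
  rw [if_pos rfl, add_comm, add_assoc, CharTwo.add_self_eq_zero, add_zero]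

theorem mem_rightInvSeq_of_eta {ω : List B} {t : W} (h : eta cs (cs.wordProd ω) t = 1) :
    t ∈ cs.rightInvSeq ω := by
  rw [eta_wordProd] at h
  by_contra hn
  rw [List.count_eq_zero_of_not_mem hn] at h
  simp at h

theorem isRightInversion_of_eta {w t : W} (h : eta cs w t = 1) : cs.IsRightInversion w t := by
  obtain ⟨ω, hω, rfl⟩ := cs.exists_isReduced w
  exact cs.isRightInversion_of_mem_rightInvSeq hω (mem_rightInvSeq_of_eta cs h)

theorem isRightInversion_iff_eta {w t : W} (ht : cs.IsReflection t) :
    cs.IsRightInversion w t ↔ eta cs w t = 1 := by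
  refine ⟨fun h => ?_, isRightInversion_of_eta cs⟩
  by_contra hn
  have h0 : eta cs w t = 0 := by
    have : ∀ a : ZMod 2, a ≠ 1 → a = 0 := by decide
    exact this _ hn
  have h1 : eta cs (w * t) t = 1 := by
    rw [eta_mul, eta_self cs ht]
    have : t * t * t⁻¹ = t := by group
    rw [this, h0, add_zero]
  have h2 := (isRightInversion_of_eta cs h1).2
  rw [mul_assoc, ht.mul_self, mul_one] at h2
  exact absurd h.2 (by omega)

end Cocycle

/-! ### Inversion sets -/

section Inversions

theorem mem_invSet_iff_eta {w t : W} :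
    t ∈ invSet cs w ↔ cs.IsReflection t ∧ eta cs w⁻¹ t = 1 := by
  change cs.IsLeftInversion w t ↔ _
  rw [← cs.isRightInversion_inv_iff]
  exact ⟨fun h => ⟨h.1, (isRightInversion_iff_eta cs h.1).1 h⟩,
    fun h => (isRightInversion_iff_eta cs h.1).2 h.2⟩

variable {cs}

theorem isReflection_of_mem_invSet {w t : W} (h : t ∈ invSet cs w) : cs.IsReflection t := h.1

theorem isReflection_conj_inv {u t : W} :
    cs.IsReflection (u⁻¹ * t * u) ↔ cs.IsReflection t := by
  simpa using cs.isReflection_conj_iff u⁻¹ t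

variable (cs)

/-- The inversion set of a product is a symmetric difference. -/
theorem mem_invSet_mul (u v t : W) :
    t ∈ invSet cs (u * v) ↔ ¬(t ∈ invSet cs u ↔ u⁻¹ * t * u ∈ invSet cs v) := by
  simp only [mem_invSet_iff_eta, isReflection_conj_inv, mul_inv_rev, eta_mul, inv_inv]
  have key : ∀ a b : ZMod 2, a + b = 1 ↔ ¬(a = 1 ↔ b = 1) := by decide
  rw [key]
  tauto

theorem invSet_one : invSet cs 1 = ∅ := by
  ext t
  simp [mem_invSet_iff_eta, eta_one]

theorem mem_invSet_inv (u t : W) : t ∈ invSet cs u⁻¹ ↔ u * t * u⁻¹ ∈ invSet cs u := by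
  have h := mem_invSet_mul cs u u⁻¹ (u * t * u⁻¹)
  have e : u⁻¹ * (u * t * u⁻¹) * u = t := by group
  rw [mul_inv_cancel, invSet_one, e] at h
  have h' := not_not.1 ((not_congr h).1 (Set.notMem_empty _))
  exact h'.symm

theorem mem_invSet_simple {s : W} (hs : s ∈ Set.range cs.simple) (t : W) :
    t ∈ invSet cs s ↔ t = s := by
  obtain ⟨i, rfl⟩ := hs
  rw [mem_invSet_iff_eta, cs.inv_simple, eta_simple]
  constructor
  · rintro ⟨_, h⟩
    by_contra hn
    rw [if_neg (fun h => hn h.symm)] at h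
    exact zero_ne_one h
  · rintro rfl
    exact ⟨cs.isReflection_simple i, if_pos rfl⟩

theorem coe_leftInvSeq_eq_invSet {ω : List B} (hω : cs.IsReduced ω) :
    {t | t ∈ cs.leftInvSeq ω} = invSet cs (cs.wordProd ω) := by
  ext t
  refine ⟨fun h => cs.isLeftInversion_of_mem_leftInvSeq hω h, fun h => ?_⟩
  have := ((mem_invSet_iff_eta cs).1 h).2
  rw [← cs.wordProd_reverse] at this
  have := mem_rightInvSeq_of_eta cs this
  rw [cs.rightInvSeq_reverse] at this
  simpa using this

theorem invSet_finite (w : W) : (invSet cs w).Finite := by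
  obtain ⟨ω, hω, rfl⟩ := cs.exists_isReduced w
  rw [← coe_leftInvSeq_eq_invSet cs hω]
  exact List.finite_toSet _

theorem ncard_invSet (w : W) : (invSet cs w).ncard = cs.length w := by
  obtain ⟨ω, hω, rfl⟩ := cs.exists_isReduced w
  rw [← coe_leftInvSeq_eq_invSet cs hω]
  have h : {t | t ∈ cs.leftInvSeq ω} = ((cs.leftInvSeq ω).toFinset : Set W) := by
    ext t; simp
  rw [h, Set.ncard_coe_finset, List.toFinset_card_of_nodup hω.nodup_leftInvSeq,
    cs.length_leftInvSeq]
  exact hω.symm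

theorem eq_one_of_invSet_eq_empty {w : W} (h : invSet cs w = ∅) : w = 1 := by
  rw [← cs.length_eq_zero_iff, ← ncard_invSet, h, Set.ncard_empty]

theorem invSet_injective : Function.Injective (invSet cs) := by
  intro u v h
  have : u⁻¹ * v = 1 := by
    apply eq_one_of_invSet_eq_empty cs
    ext t
    rw [mem_invSet_mul, mem_invSet_inv, h, inv_inv]
    simp
  rwa [inv_mul_eq_one] at this

theorem length_le_of_invSet_subset {u v : W} (h : invSet cs u ⊆ invSet cs v) :
    cs.length u ≤ cs.length v := by
  rw [← ncard_invSet, ← ncard_invSet]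
  exact Set.ncard_le_ncard h (invSet_finite cs v)

theorem eq_of_invSet_subset_of_length_le {u v : W} (h : invSet cs u ⊆ invSet cs v)
    (hl : cs.length v ≤ cs.length u) : u = v := by
  apply invSet_injective cs
  rw [← ncard_invSet, ← ncard_invSet] at hl
  exact Set.eq_of_subset_of_ncard_le h hl (invSet_finite cs v)

theorem length_mul_of_disjoint {u v : W} (h : ∀ r ∈ invSet cs v, u * r * u⁻¹ ∉ invSet cs u) :
    cs.length (u * v) = cs.length u + cs.length v := by
  have e : invSet cs (u * v) = invSet cs u ∪ (fun r => u * r * u⁻¹) '' invSet cs v := by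
    ext t
    rw [mem_invSet_mul, Set.mem_union, Set.mem_image]
    have h2 : (∃ x ∈ invSet cs v, u * x * u⁻¹ = t) ↔ u⁻¹ * t * u ∈ invSet cs v := by
      constructor
      · rintro ⟨x, hx, rfl⟩
        simpa [mul_assoc] using hx
      · intro hx
        exact ⟨_, hx, by group⟩
    have h3 : u⁻¹ * t * u ∈ invSet cs v → t ∉ invSet cs u := by
      intro hx
      simpa [mul_assoc] using h _ hx
    rw [h2]
    tauto
  rw [← ncard_invSet, e, Set.ncard_union_eq _ (invSet_finite cs u)
    ((invSet_finite cs v).image _), Set.ncard_image_of_injective, ncard_invSet, ncard_invSet]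
  · intro a b hab
    simpa using hab
  · rw [Set.disjoint_right]
    rintro _ ⟨r, hr, rfl⟩
    exact h r hr

theorem simple_of_invSet_eq_singleton {w r : W} (h : ∀ t, t ∈ invSet cs w ↔ t = r) :
    r ∈ Set.range cs.simple := by
  have h1 : invSet cs w = {r} := by ext t; simpa using h t
  have h2 : cs.length w = 1 := by rw [← ncard_invSet, h1, Set.ncard_singleton]
  obtain ⟨i, rfl⟩ := cs.length_eq_one_iff.1 h2
  exact ⟨i, (h _).1 ((mem_invSet_simple cs ⟨i, rfl⟩ _).2 rfl)⟩

theorem inv_of_simple {s : W} (hs : s ∈ Set.range cs.simple) : s⁻¹ = s := by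
  obtain ⟨i, rfl⟩ := hs
  simp

theorem isReflection_of_simple {s : W} (hs : s ∈ Set.range cs.simple) : cs.IsReflection s := by
  obtain ⟨i, rfl⟩ := hs
  exact cs.isReflection_simple i

/-- The right descent set of `w`, as a set of elements of `W`. -/
def des (w : W) : Set W := {s | s ∈ Set.range cs.simple ∧ cs.length (w * s) < cs.length w}

theorem des_subset (w : W) : des cs w ⊆ Set.range cs.simple := fun _ h => h.1

theorem mem_des_iff {w s : W} (hs : s ∈ Set.range cs.simple) :
    s ∈ des cs w ↔ w * s * w⁻¹ ∈ invSet cs w := by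
  change (_ ∧ _) ↔ (_ ∧ _)
  have : w * s * w⁻¹ * w = w * s := by group
  rw [this]
  have := (isReflection_of_simple cs hs).conj w
  tauto

theorem conj_mem_invSet {w s : W} (hs : s ∈ des cs w) : w * s * w⁻¹ ∈ invSet cs w :=
  (mem_des_iff cs hs.1).1 hs

theorem mem_invSet_mul_simple {w s : W} (hs : s ∈ Set.range cs.simple) (t : W) :
    t ∈ invSet cs (w * s) ↔ ¬(t ∈ invSet cs w ↔ t = w * s * w⁻¹) := by
  have : w⁻¹ * t * w = s ↔ t = w * s * w⁻¹ := by
    constructor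
    · rintro rfl; group
    · rintro rfl; group
  rw [mem_invSet_mul, mem_invSet_simple cs hs, this]

theorem mem_invSet_mul_des {w s : W} (hs : s ∈ des cs w) (t : W) :
    t ∈ invSet cs (w * s) ↔ t ∈ invSet cs w ∧ t ≠ w * s * w⁻¹ := by
  rw [mem_invSet_mul_simple cs hs.1]
  have := conj_mem_invSet cs hs
  by_cases h : t = w * s * w⁻¹
  · subst h; tauto
  · tauto

theorem exists_mem_des_of_ne_one {w : W} (hw : w ≠ 1) : ∃ s, s ∈ des cs w := by
  obtain ⟨i, hi⟩ := cs.exists_rightDescent_of_ne_one hw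
  exact ⟨_, ⟨i, rfl⟩, hi⟩

theorem conj_mem_des_of_invSet_diff {u v t : W} (ht : t ∈ invSet cs u)
    (h : ∀ r, r ∈ invSet cs v ↔ r ∈ invSet cs u ∧ r ≠ t) : u⁻¹ * t * u ∈ des cs u := by
  have h1 : u⁻¹ * t * u ∈ Set.range cs.simple := by
    apply simple_of_invSet_eq_singleton cs (w := u⁻¹ * v)
    intro r
    rw [mem_invSet_mul, mem_invSet_inv, inv_inv, h]
    have : u * r * u⁻¹ = t ↔ r = u⁻¹ * t * u := by
      constructor
      · rintro rfl; group
      · rintro rfl; group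
    rw [← this]
    by_cases h : u * r * u⁻¹ = t
    · rw [h]; tauto
    · tauto
  rw [mem_des_iff cs h1]
  have : u * (u⁻¹ * t * u) * u⁻¹ = t := by group
  rwa [this]

/-- A proper inclusion of inversion sets factors through a lower cover. -/
theorem exists_des_of_invSet_subset {a p : W} (h : invSet cs a ⊆ invSet cs p) (hne : a ≠ p) :
    ∃ s ∈ des cs p, invSet cs a ⊆ invSet cs (p * s) := by
  have hd : a⁻¹ * p ≠ 1 := fun h => hne (inv_mul_eq_one.1 h)
  obtain ⟨s, hs⟩ := exists_mem_des_of_ne_one cs hd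
  have hk : a⁻¹ * (p * s * p⁻¹) * a ∈ invSet cs (a⁻¹ * p) := by
    have := conj_mem_invSet cs hs
    have e : a⁻¹ * p * s * (a⁻¹ * p)⁻¹ = a⁻¹ * (p * s * p⁻¹) * a := by group
    rwa [e] at this
  have hm := mem_invSet_mul cs a (a⁻¹ * p) (p * s * p⁻¹)
  rw [mul_inv_cancel_left] at hm
  have hna : p * s * p⁻¹ ∉ invSet cs a := by
    intro ha
    have := h ha
    tauto
  have hsp : s ∈ des cs p := by
    rw [mem_des_iff cs hs.1]
    tauto
  refine ⟨s, hsp, fun t ht => (mem_invSet_mul_des cs hsp t).2 ⟨h ht, ?_⟩⟩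
  rintro rfl
  exact hna ht

end Inversions

/-! ### Parabolic subgroups -/

section Parabolic

open Subgroup

theorem exists_reduced_word_of_mem_closure {I : Set W} (hI : I ⊆ Set.range cs.simple) {w : W}
    (hw : w ∈ closure I) :
    ∃ ω : List B, cs.IsReduced ω ∧ cs.wordProd ω = w ∧ ∀ i ∈ ω, cs.simple i ∈ I := by
  have step : ∀ x : W, ∀ s ∈ I,
      (∃ ω : List B, cs.IsReduced ω ∧ cs.wordProd ω = x ∧ ∀ i ∈ ω, cs.simple i ∈ I) →
      ∃ ω : List B, cs.IsReduced ω ∧ cs.wordProd ω = x * s ∧ ∀ i ∈ ω, cs.simple i ∈ I := by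
    rintro _ s hs ⟨ω, hω, rfl, hωI⟩
    obtain ⟨i, rfl⟩ := hI hs
    rcases cs.length_mul_simple (cs.wordProd ω) i with h | h
    · refine ⟨ω ++ [i], ?_, by simp [cs.wordProd_append], ?_⟩
      · rw [CoxeterSystem.IsReduced, cs.wordProd_append, cs.wordProd_singleton, h, hω.eq]
        simp
      · intro j hj
        rcases List.mem_append.1 hj with hj | hj
        · exact hωI j hj
        · rw [List.mem_singleton.1 hj]; exact hs
    · have hr : cs.IsRightInversion (cs.wordProd ω) (cs.simple i) :=
        ⟨cs.isReflection_simple i, by omega⟩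
      rw [isRightInversion_iff_eta cs hr.1] at hr
      obtain ⟨j, hj, hji⟩ := List.getElem_of_mem (mem_rightInvSeq_of_eta cs hr)
      have e := cs.wordProd_mul_getD_rightInvSeq ω j
      rw [List.getD_eq_getElem _ _ hj, hji] at e
      refine ⟨ω.eraseIdx j, ?_, e.symm, fun k hk => hωI k (List.mem_of_mem_eraseIdx hk)⟩
      rw [CoxeterSystem.IsReduced, ← e]
      rw [cs.length_rightInvSeq] at hj
      have := List.length_eraseIdx_add_one hj
      have := hω.eq
      omega
  refine closure_induction_right (p := fun w _ => ∃ ω : List B, cs.IsReduced ω ∧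
    cs.wordProd ω = w ∧ ∀ i ∈ ω, cs.simple i ∈ I) ?_ ?_ ?_ hw
  · exact ⟨[], by simp [CoxeterSystem.IsReduced], by simp, by simp⟩
  · intro x _ s hs h
    exact step x s hs h
  · intro x _ s hs h
    rw [inv_of_simple cs (hI hs)]
    exact step x s hs h

theorem invSet_subset_closure {I : Set W} (hI : I ⊆ Set.range cs.simple) {w : W}
    (hw : w ∈ closure I) : invSet cs w ⊆ closure I := by
  induction hw using closure_induction with
  | mem s hs =>
    intro t ht
    rw [mem_invSet_simple cs (hI hs)] at ht
    rw [ht]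
    exact subset_closure hs
  | one => rw [invSet_one]; exact Set.empty_subset _
  | mul u v hu hv ihu ihv =>
    intro t ht
    rw [mem_invSet_mul] at ht
    by_cases h : t ∈ invSet cs u
    · exact ihu h
    · have := ihv (show u⁻¹ * t * u ∈ _ by tauto)
      have h2 := (closure I).mul_mem ((closure I).mul_mem hu this) ((closure I).inv_mem hu)
      have e : u * (u⁻¹ * t * u) * u⁻¹ = t := by group
      rwa [e] at h2
  | inv u hu ihu =>
    intro t ht
    rw [mem_invSet_inv] at ht
    have h2 := (closure I).mul_mem ((closure I).mul_mem ((closure I).inv_mem hu) (ihu ht)) hu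
    have e : u⁻¹ * (u * t * u⁻¹) * u = t := by group
    rwa [e] at h2

theorem mem_of_simple_of_mem_closure {I : Set W} (hI : I ⊆ Set.range cs.simple) {s : W}
    (hs : s ∈ Set.range cs.simple) (h : s ∈ closure I) : s ∈ I := by
  obtain ⟨ω, hω, hωs, hωI⟩ := exists_reduced_word_of_mem_closure cs hI h
  have h1 : ω.length = 1 := by
    rw [← hω.eq, hωs]
    obtain ⟨i, rfl⟩ := hs
    exact cs.length_simple i
  obtain ⟨i, rfl⟩ := List.length_eq_one_iff.1 h1
  rw [cs.wordProd_singleton] at hωs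
  rw [← hωs]
  exact hωI i (by simp)

theorem exists_des_of_mem_closure {I : Set W} (hI : I ⊆ Set.range cs.simple) {w : W}
    (hw : w ∈ closure I) (hne : w ≠ 1) : ∃ s ∈ I, s ∈ des cs w := by
  obtain ⟨ω, hω, rfl, hωI⟩ := exists_reduced_word_of_mem_closure cs hI hw
  rcases List.eq_nil_or_concat' ω with rfl | ⟨ω', i, rfl⟩
  · simp at hne
  · refine ⟨cs.simple i, hωI i (by simp), ⟨i, rfl⟩, ?_⟩
    rw [hω.eq, cs.wordProd_append, cs.wordProd_singleton]
    simp only [CoxeterSystem.simple_mul_simple_cancel_right, List.length_append]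
    have := cs.length_wordProd_le ω'
    simp
    omega

/-- The elements with no right descent in `I`. -/
def minReps (I : Set W) : Set W := {x | ∀ s ∈ I, s ∉ des cs x}

theorem exists_minimal_factorization (I : Set W) (w : W) :
    ∃ x p, p ∈ closure I ∧ w = x * p ∧ ∀ r ∈ closure I, x * r * x⁻¹ ∉ invSet cs x := by
  have hex : ∃ n, ∃ p ∈ closure I, cs.length (w * p) = n := ⟨_, 1, one_mem _, rfl⟩
  obtain ⟨p, hp, hlen⟩ := Nat.find_spec hex
  refine ⟨w * p, p⁻¹, inv_mem hp, by group, fun r hr hmem => ?_⟩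
  have h1 := hmem.2
  have e : w * p * r * (w * p)⁻¹ * (w * p) = w * (p * r) := by group
  rw [e, hlen] at h1
  exact Nat.find_min hex h1 ⟨p * r, mul_mem hp hr, rfl⟩

theorem conj_notMem_invSet_of_minReps {I : Set W} (hI : I ⊆ Set.range cs.simple) {x : W}
    (hx : x ∈ minReps cs I) {r : W} (hr : r ∈ closure I) : x * r * x⁻¹ ∉ invSet cs x := by
  obtain ⟨y, p, hp, rfl, hy⟩ := exists_minimal_factorization cs I x
  by_cases h1 : p = 1
  · subst h1
    simpa using hy r hr
  · exfalso
    obtain ⟨s, hsI, hs⟩ := exists_des_of_mem_closure cs hI hp h1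
    apply hx s hsI
    rw [mem_des_iff cs (hI hsI), mem_invSet_mul]
    have e1 : y * p * s * (y * p)⁻¹ = y * (p * s * p⁻¹) * y⁻¹ := by group
    have e2 : y⁻¹ * (y * (p * s * p⁻¹) * y⁻¹) * y = p * s * p⁻¹ := by group
    rw [e1, e2]
    have := hy (p * s * p⁻¹) (mul_mem (mul_mem hp (subset_closure hsI)) (inv_mem hp))
    have := conj_mem_invSet cs hs
    tauto

theorem mem_invSet_minRep_mul {I : Set W} (hI : I ⊆ Set.range cs.simple) {x p : W}
    (hx : x ∈ minReps cs I) (hp : p ∈ closure I) (t : W) :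
    t ∈ invSet cs (x * p) ↔ t ∈ invSet cs x ∨ x⁻¹ * t * x ∈ invSet cs p := by
  have h : x⁻¹ * t * x ∈ invSet cs p → t ∉ invSet cs x := by
    intro h
    have := conj_notMem_invSet_of_minReps cs hI hx (invSet_subset_closure cs hI hp h)
    have e : x * (x⁻¹ * t * x) * x⁻¹ = t := by group
    rwa [e] at this
  rw [mem_invSet_mul]
  tauto

theorem conj_mem_invSet_minRep_mul {I : Set W} (hI : I ⊆ Set.range cs.simple) {x p r : W}
    (hx : x ∈ minReps cs I) (hp : p ∈ closure I) (hr : r ∈ closure I) :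
    x * r * x⁻¹ ∈ invSet cs (x * p) ↔ r ∈ invSet cs p := by
  have := conj_notMem_invSet_of_minReps cs hI hx hr
  rw [mem_invSet_minRep_mul cs hI hx hp]
  have e : x⁻¹ * (x * r * x⁻¹) * x = r := by group
  rw [e]
  tauto

theorem length_minRep_mul {I : Set W} (hI : I ⊆ Set.range cs.simple) {x p : W}
    (hx : x ∈ minReps cs I) (hp : p ∈ closure I) :
    cs.length (x * p) = cs.length x + cs.length p :=
  length_mul_of_disjoint cs fun _ hr =>
    conj_notMem_invSet_of_minReps cs hI hx (invSet_subset_closure cs hI hp hr)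

theorem mem_des_minRep_mul {I : Set W} (hI : I ⊆ Set.range cs.simple) {x p s : W}
    (hx : x ∈ minReps cs I) (hp : p ∈ closure I) (hs : s ∈ I) :
    s ∈ des cs (x * p) ↔ s ∈ des cs p := by
  rw [mem_des_iff cs (hI hs), mem_des_iff cs (hI hs), ← conj_mem_invSet_minRep_mul cs hI hx hp
    (mul_mem (mul_mem hp (subset_closure hs)) (inv_mem hp))]
  have e : x * p * s * (x * p)⁻¹ = x * (p * s * p⁻¹) * x⁻¹ := by group
  rw [e]

/-- The inversions of any element lying in a parabolic subgroup `W_I` are the inversions of an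
element of `W_I`. -/
theorem exists_projection (I : Set W) (u : W) :
    ∃ w ∈ closure I, ∀ r ∈ closure I, r ∈ invSet cs u ↔ r ∈ invSet cs w := by
  obtain ⟨x, p, hp, hu, hx⟩ := exists_minimal_factorization cs I u⁻¹
  refine ⟨p⁻¹, inv_mem hp, fun r hr => ?_⟩
  have e : u = p⁻¹ * x⁻¹ := by rw [← inv_inv u, hu, mul_inv_rev]
  have h1 := hx (p * r * p⁻¹) (mul_mem (mul_mem hp hr) (inv_mem hp))
  rw [e, mem_invSet_mul, inv_inv, mem_invSet_inv cs x]
  tauto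

/-- The projection of `W` onto the parabolic subgroup `W_I`. -/
noncomputable def proj (I : Set W) (u : W) : W :=
  (exists_projection cs I u).choose

theorem proj_mem (I : Set W) (u : W) :
    proj cs I u ∈ closure I := (exists_projection cs I u).choose_spec.1

theorem mem_invSet_proj {I : Set W} (u : W) {r : W}
    (hr : r ∈ closure I) : r ∈ invSet cs (proj cs I u) ↔ r ∈ invSet cs u :=
  ((exists_projection cs I u).choose_spec.2 r hr).symm

theorem eq_of_mem_invSet_iff {I : Set W} (hI : I ⊆ Set.range cs.simple) {w w' : W}
    (hw : w ∈ closure I) (hw' : w' ∈ closure I)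
    (h : ∀ r ∈ closure I, r ∈ invSet cs w ↔ r ∈ invSet cs w') : w = w' := by
  apply invSet_injective cs
  ext t
  exact ⟨fun ht => (h t (invSet_subset_closure cs hI hw ht)).1 ht,
    fun ht => (h t (invSet_subset_closure cs hI hw' ht)).2 ht⟩

end Parabolic

/-! ### Longest elements of parabolic subgroups -/

section Longest

open Subgroup

theorem conj_mem_closure_iff {I : Set W} {m t : W} (hm : m ∈ closure I) :
    m⁻¹ * t * m ∈ closure I ↔ t ∈ closure I := by
  rw [mul_mem_cancel_right hm, mul_mem_cancel_left (inv_mem hm)]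

variable [Finite W]

theorem exists_longest {I : Set W} (hI : I ⊆ Set.range cs.simple) : ∃ m ∈ closure I,
    ∀ t, t ∈ invSet cs m ↔ cs.IsReflection t ∧ t ∈ closure I := by
  obtain ⟨m, hm, hmax⟩ := (Set.toFinite (closure I : Set W)).exists_maximalFor cs.length _
    ⟨1, one_mem _⟩
  refine ⟨m, hm, fun t => ⟨fun h => ⟨h.1, invSet_subset_closure cs hI hm h⟩, ?_⟩⟩
  rintro ⟨h1, h2⟩
  refine ⟨h1, ?_⟩
  have := h1.length_mul_right_ne m
  have := fun h => hmax (j := t * m) (mul_mem h2 hm) h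
  omega

variable {cs}
variable {I : Set W}

/-- The longest element of `W_I`. -/
noncomputable def longest (hI : I ⊆ Set.range cs.simple) : W := (exists_longest cs hI).choose

theorem longest_mem (hI : I ⊆ Set.range cs.simple) :
    longest hI ∈ closure I := (exists_longest cs hI).choose_spec.1

theorem mem_invSet_longest (hI : I ⊆ Set.range cs.simple) (t : W) :
    t ∈ invSet cs (longest hI) ↔ cs.IsReflection t ∧ t ∈ closure I :=
  (exists_longest cs hI).choose_spec.2 t

theorem conj_mem_invSet_longest_iff (hI : I ⊆ Set.range cs.simple) {m t : W} (hm : m ∈ closure I) :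
    m⁻¹ * t * m ∈ invSet cs (longest hI) ↔ t ∈ invSet cs (longest hI) := by
  rw [mem_invSet_longest, mem_invSet_longest, isReflection_conj_inv, conj_mem_closure_iff hm]

theorem longest_mul_self (hI : I ⊆ Set.range cs.simple) : longest hI * longest hI = 1 := by
  apply eq_one_of_invSet_eq_empty cs
  ext t
  rw [mem_invSet_mul, conj_mem_invSet_longest_iff hI (longest_mem hI)]
  simp

theorem inv_longest (hI : I ⊆ Set.range cs.simple) : (longest hI)⁻¹ = longest hI :=
  inv_eq_of_mul_eq_one_right (longest_mul_self hI)

theorem longest_conj_mem (hI : I ⊆ Set.range cs.simple)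
    {s : W} (hs : s ∈ I) : longest hI * s * longest hI ∈ I := by
  have hsm : longest hI * s * longest hI ∈ closure I :=
    mul_mem (mul_mem (longest_mem hI) (subset_closure hs)) (longest_mem hI)
  refine mem_of_simple_of_mem_closure cs hI ?_ hsm
  apply simple_of_invSet_eq_singleton cs (w := longest hI * s * longest hI)
  intro t
  rw [mem_invSet_mul, mem_invSet_mul_simple cs (hI hs),
    conj_mem_invSet_longest_iff hI (mul_mem (longest_mem hI) (subset_closure hs)), inv_longest]
  tauto

theorem longest_conj_conj (hI : I ⊆ Set.range cs.simple) (s : W) :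
    longest hI * (longest hI * s * longest hI) * longest hI = s := by
  have h := longest_mul_self hI
  have e : longest hI * (longest hI * s * longest hI) * longest hI =
    (longest hI * longest hI) * s * (longest hI * longest hI) := by group
  rw [e, h, one_mul, mul_one]

theorem mem_des_longest (hI : I ⊆ Set.range cs.simple)
    {s : W} (hs : s ∈ I) : s ∈ des cs (longest hI) := by
  rw [mem_des_iff cs (hI hs), mem_invSet_longest]
  exact ⟨(isReflection_of_simple cs (hI hs)).conj _,
    mul_mem (mul_mem (longest_mem hI) (subset_closure hs)) (inv_mem (longest_mem hI))⟩

theorem mul_longest_mem_minReps (hI : I ⊆ Set.range cs.simple)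
    {u : W} (hu : I ⊆ des cs u) : u * longest hI ∈ minReps cs I := by
  intro s hs
  have h' := longest_conj_mem hI hs
  have e : u * longest hI * s * (u * longest hI)⁻¹ =
      u * (longest hI * s * longest hI) * u⁻¹ := by
    rw [mul_inv_rev, inv_longest]; group
  have e2 : u⁻¹ * (u * (longest hI * s * longest hI) * u⁻¹) * u =
    longest hI * s * longest hI := by group
  rw [mem_des_iff cs (hI hs), e, mem_invSet_mul, e2, mem_invSet_longest]
  have h1 := conj_mem_invSet cs (hu h')
  have h2 := isReflection_of_simple cs (hI h')
  have h3 : longest hI * s * longest hI ∈ closure I := subset_closure h'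
  tauto

theorem mul_longest_mul_longest (hI : I ⊆ Set.range cs.simple)
    (u : W) : u * longest hI * longest hI = u := by
  rw [mul_assoc, longest_mul_self, mul_one]

theorem subset_des_mul_longest (hI : I ⊆ Set.range cs.simple) {x : W} (hx : x ∈ minReps cs I) :
    I ⊆ des cs (x * longest hI) := fun _ hs =>
  (mem_des_minRep_mul cs hI hx (longest_mem hI) hs).2 (mem_des_longest hI hs)

theorem mem_invSet_minRep_mul_longest (hI : I ⊆ Set.range cs.simple)
    {x : W} (hx : x ∈ minReps cs I) (t : W) :
    t ∈ invSet cs (x * longest hI) ↔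
      t ∈ invSet cs x ∨ cs.IsReflection t ∧ x⁻¹ * t * x ∈ closure I := by
  rw [mem_invSet_minRep_mul cs hI hx (longest_mem hI), mem_invSet_longest, isReflection_conj_inv]

theorem conj_mul_longest_mem_closure_iff (hI : I ⊆ Set.range cs.simple) (u t : W) :
    (u * longest hI)⁻¹ * t * (u * longest hI) ∈ closure I ↔ u⁻¹ * t * u ∈ closure I := by
  rw [← conj_mem_closure_iff (longest_mem hI) (t := u⁻¹ * t * u)]
  have e : (u * longest hI)⁻¹ * t * (u * longest hI) =
    (longest hI)⁻¹ * (u⁻¹ * t * u) * longest hI := by group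
  rw [e]

/-- If `I ⊆ D_R(u)`, all reflections of `u W_I u⁻¹` are inversions of `u`. -/
theorem mem_invSet_of_subset_des (hI : I ⊆ Set.range cs.simple)
    {u t : W} (hu : I ⊆ des cs u) (ht : cs.IsReflection t)
    (h : u⁻¹ * t * u ∈ closure I) : t ∈ invSet cs u := by
  rw [← mul_longest_mul_longest hI u,
    mem_invSet_minRep_mul_longest hI (mul_longest_mem_minReps hI hu),
    conj_mul_longest_mem_closure_iff]
  exact Or.inr ⟨ht, h⟩

/-- Removing all the reflections of `u W_I u⁻¹` from `N(u)` when `I ⊆ D_R(u)`. -/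
theorem mem_invSet_mul_longest (hI : I ⊆ Set.range cs.simple) {u : W} (hu : I ⊆ des cs u) (t : W) :
    t ∈ invSet cs (u * longest hI) ↔ t ∈ invSet cs u ∧ u⁻¹ * t * u ∉ closure I := by
  rw [mem_invSet_mul, mem_invSet_longest, isReflection_conj_inv]
  have := mem_invSet_of_subset_des hI hu (t := t)
  have := isReflection_of_mem_invSet (cs := cs) (w := u) (t := t)
  tauto

theorem mem_of_invSet_eq_compl (hI : I ⊆ Set.range cs.simple)
    {w r : W} (hw : w ∈ closure I) (hr : r ∈ closure I)
    (hrefl : cs.IsReflection r)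
    (h : ∀ t ∈ closure I, cs.IsReflection t → (t ∈ invSet cs w ↔ t ≠ r)) : r ∈ I := by
  refine mem_of_simple_of_mem_closure cs hI ?_ hr
  apply simple_of_invSet_eq_singleton cs (w := w * longest hI)
  intro t
  rw [mem_invSet_mul, conj_mem_invSet_longest_iff hI hw, mem_invSet_longest]
  by_cases ht : cs.IsReflection t ∧ t ∈ closure I
  · have := h t ht.2 ht.1
    tauto
  · have h1 : t ∉ invSet cs w := fun h => ht ⟨h.1, invSet_subset_closure cs hI hw h⟩
    have h2 : t ≠ r := by rintro rfl; exact ht ⟨hrefl, hr⟩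
    tauto

/-- A reflection whose removal from an inversion set containing all the reflections of `q W_I q⁻¹`
yields an inversion set is, if it belongs to `q W_I q⁻¹`, one of its canonical generators. -/
theorem mem_of_conj_mem_closure_of_des (hI : I ⊆ Set.range cs.simple)
    {z q s : W} (hq : q ∈ minReps cs I) (hs : s ∈ des cs z)
    (hz : ∀ r ∈ closure I, cs.IsReflection r → q * r * q⁻¹ ∈ invSet cs z)
    (h : q⁻¹ * (z * s * z⁻¹) * q ∈ closure I) : q⁻¹ * (z * s * z⁻¹) * q ∈ I := by
  have hrefl : cs.IsReflection (q⁻¹ * (z * s * z⁻¹) * q) :=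
    isReflection_conj_inv.2 ((isReflection_of_simple cs hs.1).conj z)
  refine mem_of_invSet_eq_compl hI (proj_mem cs I (q⁻¹ * (z * s))) h hrefl fun t ht htr => ?_
  rw [mem_invSet_proj cs _ ht, mem_invSet_mul, mem_invSet_inv, inv_inv,
    mem_invSet_mul_des cs hs]
  have h1 := conj_notMem_invSet_of_minReps cs hI hq ht
  have h2 := hz t ht htr
  have h3 : t = q⁻¹ * (z * s * z⁻¹) * q ↔ q * t * q⁻¹ = z * s * z⁻¹ := by
    constructor
    · rintro rfl; group
    · intro h; rw [← h]; group
  rw [ne_eq, ne_eq, h3]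
  tauto

end Longest

/-! ### Minimal elements with prescribed cover inversions -/

section MinAbove

open Subgroup

/-- The elements below `z` in the weak order having all the cover inversions `z s z⁻¹`, `s ∈ K`. -/
def aboveCovers (z : W) (K : Set W) : Set W :=
  {c | invSet cs c ⊆ invSet cs z ∧ ∀ s ∈ K, z * s * z⁻¹ ∈ invSet cs c}

variable {cs}

theorem aboveCovers_of_subset {z c d : W} {K : Set W} (hd : d ∈ aboveCovers cs z K)
    (h1 : invSet cs d ⊆ invSet cs c) (h2 : invSet cs c ⊆ invSet cs z) : c ∈ aboveCovers cs z K :=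
  ⟨h2, fun s hs => h1 (hd.2 s hs)⟩

variable [Finite W]

theorem mul_longest_mem_aboveCovers {z p s₁ s₂ : W} {K : Set W} (hK : K ⊆ des cs z)
    (h₁ : s₁ ∈ des cs p) (h₂ : s₂ ∈ des cs p)
    (hp₁ : p * s₁ ∈ aboveCovers cs z K) (hp₂ : p * s₂ ∈ aboveCovers cs z K)
    (hp : p ∈ aboveCovers cs z K) (hI : {s₁, s₂} ⊆ Set.range cs.simple) :
    p * longest hI ∈ aboveCovers cs z K := by
  have hd : {s₁, s₂} ⊆ des cs p := by
    rintro s (rfl | rfl) <;> assumption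
  refine ⟨fun t ht => hp.1 ((mem_invSet_mul_longest hI hd t).1 ht).1, fun s hs => ?_⟩
  rw [mem_invSet_mul_longest hI hd]
  refine ⟨hp.2 s hs, fun hcl => ?_⟩
  rw [← conj_mul_longest_mem_closure_iff hI] at hcl
  have hq := mul_longest_mem_minReps hI hd
  have hmem := mem_of_conj_mem_closure_of_des hI hq (hK hs) (fun r hr hrr => hp.1 ?_) hcl
  · have key : ∀ s' ∈ ({s₁, s₂} : Set W), z * s * z⁻¹ ≠ p * s' * p⁻¹ := by
      rintro s' (rfl | rfl)
      · exact ((mem_invSet_mul_des cs h₁ _).1 (hp₁.2 s hs)).2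
      · exact ((mem_invSet_mul_des cs h₂ _).1 (hp₂.2 s hs)).2
    refine key _ (longest_conj_mem hI hmem) ?_
    rw [mul_inv_rev, inv_longest]
    have e : longest hI * (longest hI * p⁻¹ * (z * s * z⁻¹) * (p * longest hI)) * longest hI =
      (longest hI * longest hI) * (p⁻¹ * (z * s * z⁻¹) * p) * (longest hI * longest hI) := by group
    rw [e, longest_mul_self]
    group
  · apply mem_invSet_of_subset_des hI hd (hrr.conj _)
    rw [← conj_mul_longest_mem_closure_iff hI]
    have e : (p * longest hI)⁻¹ * (p * longest hI * r * (p * longest hI)⁻¹) * (p * longest hI) =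
      r := by group
    rwa [e]

theorem exists_lower_bound_aboveCovers {z : W} {K : Set W} (hK : K ⊆ des cs z) (n : ℕ) :
    ∀ p a b : W, cs.length p = n → p ∈ aboveCovers cs z K → a ∈ aboveCovers cs z K →
      b ∈ aboveCovers cs z K → invSet cs a ⊆ invSet cs p → invSet cs b ⊆ invSet cs p →
      ∃ c ∈ aboveCovers cs z K, invSet cs c ⊆ invSet cs a ∧ invSet cs c ⊆ invSet cs b := by
  induction n using Nat.strong_induction_on with
  | _ n ih =>
    intro p a b hn hp ha hb hap hbp
    by_cases hpa : a = p
    · exact ⟨b, hb, hpa ▸ hbp, subset_rfl⟩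
    by_cases hpb : b = p
    · exact ⟨a, ha, subset_rfl, hpb ▸ hap⟩
    obtain ⟨s₁, h₁, ha₁⟩ := exists_des_of_invSet_subset cs hap hpa
    obtain ⟨s₂, h₂, hb₂⟩ := exists_des_of_invSet_subset cs hbp hpb
    have sub : ∀ s ∈ des cs p, invSet cs (p * s) ⊆ invSet cs p := fun s hs t ht =>
      ((mem_invSet_mul_des cs hs t).1 ht).1
    have hp₁ : p * s₁ ∈ aboveCovers cs z K :=
      aboveCovers_of_subset ha ha₁ ((sub _ h₁).trans hp.1)
    have hp₂ : p * s₂ ∈ aboveCovers cs z K :=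
      aboveCovers_of_subset hb hb₂ ((sub _ h₂).trans hp.1)
    have hI : {s₁, s₂} ⊆ Set.range cs.simple := by
      rintro s (rfl | rfl)
      exacts [h₁.1, h₂.1]
    have hd : {s₁, s₂} ⊆ des cs p := by
      rintro s (rfl | rfl) <;> assumption
    have hq := mul_longest_mem_aboveCovers hK h₁ h₂ hp₁ hp₂ hp hI
    have hqs : ∀ s ∈ ({s₁, s₂} : Set W),
        invSet cs (p * longest hI) ⊆ invSet cs (p * s) := by
      intro s hs t ht
      rw [mem_invSet_mul_longest hI hd] at ht
      rw [mem_invSet_mul_des cs (hd hs)]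
      refine ⟨ht.1, ?_⟩
      rintro rfl
      apply ht.2
      have e : p⁻¹ * (p * s * p⁻¹) * p = s := by group
      rw [e]
      exact subset_closure hs
    obtain ⟨c₁, hc₁, hca, hcq⟩ := ih _ (hn ▸ h₁.2) (p * s₁) a (p * longest hI) rfl hp₁ ha hq ha₁
      (hqs s₁ (by simp))
    obtain ⟨c, hc, hcc, hcb⟩ := ih _ (hn ▸ h₂.2) (p * s₂) c₁ b rfl hp₂ hc₁ hb
      (hcq.trans (hqs s₂ (by simp))) hb₂
    exact ⟨c, hc, hcc.trans hca, hcb⟩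

theorem exists_least_aboveCovers {z : W} {K : Set W} (hK : K ⊆ des cs z) :
    ∃ c ∈ aboveCovers cs z K, ∀ b ∈ aboveCovers cs z K, invSet cs c ⊆ invSet cs b := by
  have hz : z ∈ aboveCovers cs z K := ⟨subset_rfl, fun s hs => conj_mem_invSet cs (hK hs)⟩
  obtain ⟨m, hm, hmin⟩ := (Set.toFinite (aboveCovers cs z K)).exists_minimalFor cs.length _
    ⟨z, hz⟩
  refine ⟨m, hm, fun b hb => ?_⟩
  obtain ⟨c, hc, hcm, hcb⟩ := exists_lower_bound_aboveCovers hK _ z m b rfl hz hm hb hm.1 hb.1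
  have := eq_of_invSet_subset_of_length_le cs hcm (hmin hc (length_le_of_invSet_subset cs hcm))
  rwa [← this]

/-- The least element below `z` having all the cover inversions `z s z⁻¹`, `s ∈ K`. -/
noncomputable def leastAbove {z : W} {K : Set W} (hK : K ⊆ des cs z) : W :=
  (exists_least_aboveCovers hK).choose

theorem leastAbove_mem {z : W} {K : Set W} (hK : K ⊆ des cs z) :
    leastAbove hK ∈ aboveCovers cs z K := (exists_least_aboveCovers hK).choose_spec.1

theorem invSet_leastAbove_subset {z b : W} {K : Set W} (hK : K ⊆ des cs z)
    (hb : b ∈ aboveCovers cs z K) : invSet cs (leastAbove hK) ⊆ invSet cs b :=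
  (exists_least_aboveCovers hK).choose_spec.2 b hb

/-- An element of `aboveCovers` all of whose cover inversions are among the prescribed ones is the
least one. -/
theorem eq_leastAbove {z u : W} {K : Set W} (hK : K ⊆ des cs z) (hu : u ∈ aboveCovers cs z K)
    (h : ∀ s ∈ des cs u, ∃ s' ∈ K, u * s * u⁻¹ = z * s' * z⁻¹) : u = leastAbove hK := by
  by_contra hne
  obtain ⟨s, hs, hsub⟩ := exists_des_of_invSet_subset cs (invSet_leastAbove_subset hK hu)
    (Ne.symm hne)
  obtain ⟨s', hs', he⟩ := h s hs
  have h1 := hsub ((leastAbove_mem hK).2 s' hs')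
  rw [mem_invSet_mul_des cs hs] at h1
  exact h1.2 he.symm

theorem exists_of_mem_des_leastAbove {z s : W} {K : Set W} (hK : K ⊆ des cs z)
    (hs : s ∈ des cs (leastAbove hK)) :
    ∃ s' ∈ K, leastAbove hK * s * (leastAbove hK)⁻¹ = z * s' * z⁻¹ := by
  by_contra! hn
  set u := leastAbove hK with hu
  have hmem := leastAbove_mem hK
  rw [← hu] at hmem
  have hsub : invSet cs (u * s) ⊆ invSet cs u := fun t ht => ((mem_invSet_mul_des cs hs t).1 ht).1
  have h1 : u * s ∈ aboveCovers cs z K := by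
    refine ⟨hsub.trans hmem.1, fun s' hs' => ?_⟩
    rw [mem_invSet_mul_des cs hs]
    exact ⟨hmem.2 s' hs', fun h => hn s' hs' h.symm⟩
  have h2 := length_le_of_invSet_subset cs (invSet_leastAbove_subset hK h1)
  exact absurd hs.2 (by rw [← hu] at h2; omega)

/-- Dropping one of the cover inversions indexed by `K` strictly weakens the condition defining
`aboveCovers`. -/
theorem exists_mem_aboveCovers_notMem {z s : W} {K : Set W} (hK : K ⊆ des cs z) (hs : s ∈ K) :
    ∃ c ∈ aboveCovers cs z (K \ {s}), z * s * z⁻¹ ∉ invSet cs c := by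
  have hKS : K ⊆ Set.range cs.simple := hK.trans (des_subset cs z)
  set m := longest hKS with hm
  have hmm : m * m = 1 := longest_mul_self hKS
  have hminv : m⁻¹ = m := inv_longest hKS
  set L : Set W := {r | m * r * m ∈ K \ {s}} with hL
  have hLK : L ⊆ K := fun r hr => by
    have := longest_conj_mem hKS hr.1
    rwa [← hm, hm, longest_conj_conj] at this
  have hLS : L ⊆ Set.range cs.simple := hLK.trans hKS
  have hy := mul_longest_mem_minReps hKS hK
  rw [← hm] at hy
  have hyL : z * m ∈ minReps cs L := fun r hr => hy r (hLK hr)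
  have conj : ∀ r : W, (z * m)⁻¹ * (z * r * z⁻¹) * (z * m) = m * r * m := by
    intro r
    rw [mul_inv_rev, hminv]; group
  have conj2 : ∀ r : W, m * (m * r * m) * m = r := longest_conj_conj hKS
  refine ⟨z * m * longest hLS, ⟨fun t ht => ?_, fun r hr => ?_⟩, fun h => ?_⟩
  · rw [mem_invSet_minRep_mul_longest hLS hyL] at ht
    have e : z = z * m * m := by rw [mul_assoc, hmm, mul_one]
    rw [e, mem_invSet_minRep_mul_longest hKS hy]
    exact ht.imp_right fun h => ⟨h.1, closure_mono hLK h.2⟩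
  · rw [mem_invSet_minRep_mul_longest hLS hyL, conj]
    refine Or.inr ⟨(isReflection_of_simple cs (hKS hr.1)).conj z, subset_closure ?_⟩
    show m * (m * r * m) * m ∈ K \ {s}
    rwa [conj2]
  · rw [mem_invSet_minRep_mul_longest hLS hyL, conj] at h
    have hsK := longest_conj_mem hKS hs
    rw [← hm] at hsK
    rcases h with h | h
    · have h1 := conj_notMem_invSet_of_minReps cs hKS hy (subset_closure hsK)
      have e : z * m * (m * s * m) * (z * m)⁻¹ = z * s * z⁻¹ := by
        rw [← conj s]; group
      exact h1 (e ▸ h)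
    · have h1 := mem_of_simple_of_mem_closure cs hLS (hKS hsK) h.2
      have h2 : m * (m * s * m) * m ∈ K \ {s} := h1
      rw [conj2] at h2
      exact h2.2 rfl

theorem exists_mem_des_leastAbove {z s : W} {K : Set W} (hK : K ⊆ des cs z) (hs : s ∈ K) :
    ∃ r ∈ des cs (leastAbove hK), leastAbove hK * r * (leastAbove hK)⁻¹ = z * s * z⁻¹ := by
  by_contra! hn
  have hK' : K \ {s} ⊆ des cs z := fun r hr => hK hr.1
  have hmem := leastAbove_mem hK
  have h1 : leastAbove hK = leastAbove hK' := by
    apply eq_leastAbove hK' ⟨hmem.1, fun r hr => hmem.2 r hr.1⟩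
    intro r hr
    obtain ⟨s', hs', he⟩ := exists_of_mem_des_leastAbove hK hr
    refine ⟨s', ⟨hs', ?_⟩, he⟩
    rintro rfl
    exact hn r hr he
  obtain ⟨c, hc, hcs⟩ := exists_mem_aboveCovers_notMem hK hs
  apply hcs
  apply invSet_leastAbove_subset hK' hc
  rw [← h1]
  exact hmem.2 s hs

end MinAbove

/-! ### Lower intervals of the shard order -/

section Shard

open Subgroup

variable {cs}

theorem des_subset_of_mem_closure {I : Set W} (hI : I ⊆ Set.range cs.simple) {w : W}
    (hw : w ∈ closure I) : des cs w ⊆ I := fun s hs => by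
  have h := invSet_subset_closure cs hI hw (conj_mem_invSet cs hs)
  refine mem_of_simple_of_mem_closure cs hI hs.1 ?_
  rwa [SetLike.mem_coe, mul_mem_cancel_right (inv_mem hw), mul_mem_cancel_left hw] at h

theorem mem_closure_of_invSet_subset {I : Set W} (hI : I ⊆ Set.range cs.simple) {w : W}
    (hw : invSet cs w ⊆ closure I) : w ∈ closure I := by
  have : w = proj cs I w := by
    apply invSet_injective cs
    ext t
    constructor
    · exact fun h => (mem_invSet_proj cs w (hw h)).2 h
    · exact fun h => (mem_invSet_proj cs w
        (invSet_subset_closure cs hI (proj_mem cs I w) h)).1 h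
  rw [this]
  exact proj_mem cs I w

theorem descConj_eq_closure (w : W) :
    descConj cs w = closure ((fun s => w * s * w⁻¹) '' des cs w) := by
  rw [descConj]
  congr 1
  ext t
  constructor
  · rintro ⟨i, hi, rfl⟩
    exact ⟨_, ⟨⟨i, rfl⟩, hi⟩, rfl⟩
  · rintro ⟨_, ⟨⟨i, rfl⟩, hi⟩, rfl⟩
    exact ⟨i, hi, rfl⟩

theorem descConj_eq_map (w : W) :
    descConj cs w = (closure (des cs w)).map (MulAut.conj w).toMonoidHom := by
  rw [descConj_eq_closure, MonoidHom.map_closure]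
  rfl

theorem mem_descConj {w t : W} : t ∈ descConj cs w ↔ w⁻¹ * t * w ∈ closure (des cs w) := by
  rw [descConj_eq_map, mem_map]
  constructor
  · rintro ⟨r, hr, rfl⟩
    have e : w⁻¹ * (w * r * w⁻¹) * w = r := by group
    simpa [e] using hr
  · intro h
    refine ⟨_, h, ?_⟩
    change w * (w⁻¹ * t * w) * w⁻¹ = t
    group

theorem conj_mem_descConj {w s : W} (hs : s ∈ des cs w) : w * s * w⁻¹ ∈ descConj cs w := by
  rw [descConj_eq_closure]
  exact subset_closure ⟨s, hs, rfl⟩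

theorem descConj_le {w : W} {H : Subgroup W} (h : ∀ s ∈ des cs w, w * s * w⁻¹ ∈ H) :
    descConj cs w ≤ H := by
  rw [descConj_eq_closure, closure_le]
  rintro _ ⟨s, hs, rfl⟩
  exact h s hs

variable (cs) in
theorem shardLE_refl (u : W) : shardLE cs u u := ⟨subset_rfl, le_rfl⟩

theorem shardLE_trans {u v w : W} (h₁ : shardLE cs u v) (h₂ : shardLE cs v w) : shardLE cs u w :=
  ⟨h₁.1.trans h₂.1, h₁.2.trans h₂.2⟩

theorem shardLE_antisymm {u v : W} (h₁ : shardLE cs u v) (h₂ : shardLE cs v u) : u = v :=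
  invSet_injective cs (h₁.1.antisymm h₂.1)

variable [Finite W]

variable (cs) in
/-- The minimal length representative of `v W_{D_R(v)}`. -/
noncomputable def base (v : W) : W := v * longest (des_subset cs v)

variable (cs) in
/-- The projection of the lower interval of `v` in the shard order to `W_{D_R(v)}`. -/
noncomputable def shardProj (v u : W) : W := proj cs (des cs v) ((base cs v)⁻¹ * u)

theorem base_mem_minReps (v : W) : base cs v ∈ minReps cs (des cs v) :=
  mul_longest_mem_minReps _ subset_rfl

theorem mem_descConj_iff_base {v t : W} :
    t ∈ descConj cs v ↔ (base cs v)⁻¹ * t * base cs v ∈ closure (des cs v) := by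
  rw [base, conj_mul_longest_mem_closure_iff, mem_descConj]

theorem conj_base_mem_descConj {v r : W} (hr : r ∈ closure (des cs v)) :
    base cs v * r * (base cs v)⁻¹ ∈ descConj cs v := by
  rw [mem_descConj_iff_base]
  have e : (base cs v)⁻¹ * (base cs v * r * (base cs v)⁻¹) * base cs v = r := by group
  rwa [e]

theorem mem_invSet_iff_base {v t : W} : t ∈ invSet cs v ↔
    t ∈ invSet cs (base cs v) ∨ cs.IsReflection t ∧ t ∈ descConj cs v := by
  rw [mem_descConj_iff_base, ← mem_invSet_minRep_mul_longest (des_subset cs v)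
    (base_mem_minReps v), base, mul_longest_mul_longest]

theorem shardProj_mem (v u : W) : shardProj cs v u ∈ closure (des cs v) := proj_mem cs _ _

theorem mem_invSet_shardProj {v u r : W} (hr : r ∈ closure (des cs v)) :
    r ∈ invSet cs (shardProj cs v u) ↔ base cs v * r * (base cs v)⁻¹ ∈ invSet cs u := by
  have h := conj_notMem_invSet_of_minReps cs (des_subset cs v) (base_mem_minReps v) hr
  rw [shardProj, mem_invSet_proj cs _ hr, mem_invSet_mul, mem_invSet_inv, inv_inv]
  tauto

theorem des_subset_des_base_mul {v w : W} (hw : w ∈ closure (des cs v)) :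
    des cs w ⊆ des cs (base cs v * w) := fun _ hs =>
  (mem_des_minRep_mul cs (des_subset cs v) (base_mem_minReps v) hw
    (des_subset_of_mem_closure (des_subset cs v) hw hs)).2 hs

theorem exists_mem_des_shardProj {v u s : W} (hu : shardLE cs u v) (hs : s ∈ des cs u) :
    ∃ s' ∈ des cs (shardProj cs v u), u * s * u⁻¹ =
      base cs v * shardProj cs v u * s' * (base cs v * shardProj cs v u)⁻¹ := by
  set b := base cs v with hb
  set w := shardProj cs v u with hw
  have hr := mem_descConj_iff_base.1 (hu.2 (conj_mem_descConj hs))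
  rw [← hb] at hr
  have e : b * (b⁻¹ * (u * s * u⁻¹) * b) * b⁻¹ = u * s * u⁻¹ := by group
  refine ⟨w⁻¹ * (b⁻¹ * (u * s * u⁻¹) * b) * w, ?_, by group⟩
  refine conj_mem_des_of_invSet_diff cs (v := shardProj cs v (u * s)) ?_ fun q => ?_
  · rw [hw, mem_invSet_shardProj hr, ← hb, e]
    exact conj_mem_invSet cs hs
  · by_cases hq : q ∈ closure (des cs v)
    · rw [hw, mem_invSet_shardProj hq, mem_invSet_shardProj hq, mem_invSet_mul_des cs hs, ← hb]
      have : b * q * b⁻¹ = u * s * u⁻¹ ↔ q = b⁻¹ * (u * s * u⁻¹) * b := by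
        constructor
        · intro h; rw [← h]; group
        · rintro rfl; exact e
      rw [ne_eq, ne_eq, this]
    · have h1 : ∀ y, q ∉ invSet cs (shardProj cs v y) := fun y h =>
        hq (invSet_subset_closure cs (des_subset cs v) (shardProj_mem v y) h)
      have := h1 u
      have := h1 (u * s)
      tauto

theorem mem_aboveCovers_shardProj {v u : W} (hu : shardLE cs u v) :
    u ∈ aboveCovers cs (base cs v * shardProj cs v u) (des cs (shardProj cs v u)) := by
  refine ⟨fun t ht => ?_, fun s hs => ?_⟩
  · rw [mem_invSet_minRep_mul cs (des_subset cs v) (base_mem_minReps v) (shardProj_mem v u)]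
    refine (mem_invSet_iff_base.1 (hu.1 ht)).imp_right fun h => ?_
    rw [mem_invSet_shardProj (mem_descConj_iff_base.1 h.2)]
    have e : base cs v * ((base cs v)⁻¹ * t * base cs v) * (base cs v)⁻¹ = t := by group
    rwa [e]
  · have h := conj_mem_invSet cs hs
    have h' := invSet_subset_closure cs (des_subset cs v) (shardProj_mem v u) h
    rw [mem_invSet_shardProj h'] at h
    convert h using 1
    group

theorem eq_leastAbove_shardProj {v u : W} (hu : shardLE cs u v) :
    u = leastAbove (des_subset_des_base_mul (shardProj_mem (cs := cs) v u)) :=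
  eq_leastAbove _ (mem_aboveCovers_shardProj hu) fun _ hs => exists_mem_des_shardProj hu hs

theorem shardProj_injOn (v : W) : Set.InjOn (shardProj cs v) {u | shardLE cs u v} := by
  intro u hu u' hu' h
  rw [eq_leastAbove_shardProj hu, eq_leastAbove_shardProj hu']
  simp only [h]

theorem descConj_eq_map_shardProj {v u : W} (hu : shardLE cs u v) : descConj cs u =
    (descConj cs (shardProj cs v u)).map (MulAut.conj (base cs v)).toMonoidHom := by
  rw [descConj_eq_closure, descConj_eq_closure, MonoidHom.map_closure]
  congr 1
  ext t
  constructor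
  · rintro ⟨s, hs, rfl⟩
    obtain ⟨s', hs', e⟩ := exists_mem_des_shardProj hu hs
    refine ⟨_, ⟨s', hs', rfl⟩, ?_⟩
    change base cs v * (shardProj cs v u * s' * (shardProj cs v u)⁻¹) * (base cs v)⁻¹ =
      u * s * u⁻¹
    rw [e]
    group
  · rintro ⟨_, ⟨s', hs', rfl⟩, rfl⟩
    obtain ⟨s, hs, e⟩ := exists_mem_des_leastAbove
      (des_subset_des_base_mul (shardProj_mem (cs := cs) v u)) hs'
    rw [← eq_leastAbove_shardProj hu] at hs e
    refine ⟨s, hs, ?_⟩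
    change _ = base cs v * (shardProj cs v u * s' * (shardProj cs v u)⁻¹) * (base cs v)⁻¹
    change u * s * u⁻¹ = _
    rw [e]
    group

theorem exists_shardProj_eq {v w : W} (hw : w ∈ closure (des cs v)) :
    ∃ u, shardLE cs u v ∧ shardProj cs v u = w := by
  have hK := des_subset_des_base_mul hw
  have hmem := leastAbove_mem hK
  refine ⟨leastAbove hK, ⟨fun t ht => ?_, descConj_le fun s hs => ?_⟩, ?_⟩
  · have ht' := hmem.1 ht
    rw [mem_invSet_minRep_mul cs (des_subset cs v) (base_mem_minReps v) hw] at ht'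
    rw [mem_invSet_iff_base, mem_descConj_iff_base]
    exact ht'.imp_right fun h =>
      ⟨isReflection_conj_inv.1 h.1, invSet_subset_closure cs (des_subset cs v) hw h⟩
  · obtain ⟨s', hs', e⟩ := exists_of_mem_des_leastAbove hK hs
    have h := conj_base_mem_descConj
      (invSet_subset_closure cs (des_subset cs v) hw (conj_mem_invSet cs hs'))
    rw [e]
    convert h using 1
    group
  · by_contra hne
    have hsub : invSet cs (shardProj cs v (leastAbove hK)) ⊆ invSet cs w := by
      intro q hq
      have hq' := invSet_subset_closure cs (des_subset cs v) (shardProj_mem v _) hq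
      rw [mem_invSet_shardProj hq'] at hq
      exact (conj_mem_invSet_minRep_mul cs (des_subset cs v) (base_mem_minReps v) hw hq').1
        (hmem.1 hq)
    obtain ⟨s, hs, hsub'⟩ := exists_des_of_invSet_subset cs hsub hne
    have h := hmem.2 s hs
    have e : base cs v * w * s * (base cs v * w)⁻¹ =
      base cs v * (w * s * w⁻¹) * (base cs v)⁻¹ := by group
    rw [e, ← mem_invSet_shardProj (invSet_subset_closure cs (des_subset cs v) hw
      (conj_mem_invSet cs hs))] at h
    exact ((mem_invSet_mul_des cs hs _).1 (hsub' h)).2 rfl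

theorem shardProj_mono {v u u' : W} (hu : shardLE cs u v) (hu' : shardLE cs u' v)
    (h : shardLE cs u u') : shardLE cs (shardProj cs v u) (shardProj cs v u') := by
  refine ⟨fun q hq => ?_, ?_⟩
  · have hq' := invSet_subset_closure cs (des_subset cs v) (shardProj_mem v _) hq
    rw [mem_invSet_shardProj hq'] at hq ⊢
    exact h.1 hq
  · have := h.2
    rw [descConj_eq_map_shardProj hu, descConj_eq_map_shardProj hu'] at this
    exact (map_le_map_iff_of_injective (MulAut.conj (base cs v)).injective).1 this

theorem ncard_shardLE (v : W) : {u | shardLE cs u v}.ncard = Nat.card (descConj cs v) := by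
  rw [descConj_eq_map, Nat.card_congr ((closure (des cs v)).equivMapOfInjective _
    (MulAut.conj v).injective).symm.toEquiv, ← (shardProj_injOn v).ncard_image]
  change _ = Nat.card (closure (des cs v) : Set W)
  rw [Nat.card_coe_set_eq]
  congr 1
  ext w
  constructor
  · rintro ⟨u, _, rfl⟩
    exact shardProj_mem v u
  · intro hw
    obtain ⟨u, hu, rfl⟩ := exists_shardProj_eq hw
    exact ⟨u, hu, rfl⟩

theorem shardLE_of_shardProj {v u u' : W} (hu : shardLE cs u v) (hu' : shardLE cs u' v)
    (h : shardLE cs (shardProj cs v u) (shardProj cs v u')) : shardLE cs u u' := by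
  have hsub : {y | shardLE cs y u'} ⊆ {y | shardLE cs y v} := fun y hy => shardLE_trans hy hu'
  have himage : shardProj cs v '' {y | shardLE cs y u'} =
      {y | shardLE cs y (shardProj cs v u')} := by
    refine Set.eq_of_subset_of_ncard_le ?_ ?_ (Set.toFinite _)
    · rintro _ ⟨y, hy, rfl⟩
      exact shardProj_mono (hsub hy) hu' hy
    · rw [((shardProj_injOn v).mono hsub).ncard_image, ncard_shardLE, ncard_shardLE,
        descConj_eq_map_shardProj hu']
      exact (Nat.card_congr ((descConj cs (shardProj cs v u')).equivMapOfInjective _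
        (MulAut.conj (base cs v)).injective).toEquiv).le
  obtain ⟨y, hy, e⟩ : shardProj cs v u ∈ shardProj cs v '' {y | shardLE cs y u'} := by
    rw [himage]
    exact h
  rwa [← shardProj_injOn v (hsub hy) hu e]

theorem shardProj_self (v : W) : shardProj cs v v = longest (des_subset cs v) := by
  apply eq_of_mem_invSet_iff cs (des_subset cs v) (shardProj_mem v v) (longest_mem _)
  intro r hr
  rw [mem_invSet_shardProj hr, mem_invSet_longest, mem_invSet_iff_base]
  have h1 := conj_notMem_invSet_of_minReps cs (des_subset cs v) (base_mem_minReps v) hr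
  have h2 := conj_base_mem_descConj hr
  rw [cs.isReflection_conj_iff]
  tauto

theorem shardLE_longest_iff {I : Set W} (hI : I ⊆ Set.range cs.simple) {w : W} :
    shardLE cs w (longest hI) ↔ w ∈ closure I := by
  constructor
  · exact fun h => mem_closure_of_invSet_subset hI
      (h.1.trans (invSet_subset_closure cs hI (longest_mem hI)))
  · intro hw
    refine ⟨fun t ht => (mem_invSet_longest hI t).2 ⟨ht.1, invSet_subset_closure cs hI hw ht⟩,
      descConj_le fun s hs => ?_⟩
    rw [mem_descConj]
    refine closure_mono (fun s hs => mem_des_longest hI hs) ?_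
    rw [conj_mem_closure_iff (longest_mem hI)]
    exact invSet_subset_closure cs hI hw (conj_mem_invSet cs hs)

end Shard

/-! ### Counting chains -/

section Chains

theorem card_chains_swap {α : Type*} (r : α → α → Prop) (n : ℕ) :
    Nat.card {c : Fin n → α // ∀ i j, i < j → r (c i) (c j)} =
      Nat.card {c : Fin n → α // ∀ i j, i < j → r (c j) (c i)} := by
  refine Nat.card_congr (Equiv.subtypeEquiv (Equiv.arrowCongr Fin.revPerm (Equiv.refl α)) ?_)
  intro c
  constructor
  · intro h i j hij
    exact h _ _ (Fin.rev_lt_rev.2 hij)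
  · intro h i j hij
    simpa using h _ _ (Fin.rev_lt_rev.2 hij)

variable {α β : Type*} [Fintype α] [Fintype β]

/-- The number of sequences `a = a₀, a₁, …, aₖ` with `r aᵢ aᵢ₊₁` for all `i`. -/
noncomputable def chainsFrom (r : α → α → Prop) : ℕ → α → ℕ
  | 0, _ => 1
  | k + 1, a => ∑ b with r a b, chainsFrom r k b

/-- Splitting off the first element of a chain. -/
def chainEquiv {r : α → α → Prop} (hr : ∀ a b c, r a b → r b c → r a c) (k : ℕ) (a : α) :
    {c : Fin (k + 2) → α // (∀ i j, i < j → r (c i) (c j)) ∧ c 0 = a} ≃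
      Σ b : {b // r a b}, {c : Fin (k + 1) → α // (∀ i j, i < j → r (c i) (c j)) ∧ c 0 = b.1} where
  toFun c := ⟨⟨c.1 1, by
      have h := c.2.1 0 1 (by simp)
      rwa [c.2.2] at h⟩,
    ⟨Fin.tail c.1, fun i j h => c.2.1 _ _ (Fin.succ_lt_succ_iff.2 h), rfl⟩⟩
  invFun c := ⟨Fin.cons a c.2.1, by
    refine ⟨fun i j => ?_, rfl⟩
    have h0 : ∀ j, r a (c.2.1 j) := fun j => by
      rcases eq_or_ne j 0 with rfl | hj
      · rw [c.2.2.2]; exact c.1.2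
      · have h := c.2.2.1 _ _ (Fin.pos_iff_ne_zero.2 hj)
        rw [c.2.2.2] at h
        exact hr _ _ _ c.1.2 h
    refine Fin.cases ?_ (fun i => ?_) i <;> refine Fin.cases ?_ (fun j => ?_) j
    · intro h; exact absurd h (lt_irrefl _)
    · intro _; exact h0 j
    · intro h; exact absurd h (by simp)
    · intro h; exact c.2.2.1 _ _ (Fin.succ_lt_succ_iff.1 h)⟩
  left_inv c := by
    obtain ⟨c, hc, rfl⟩ := c
    exact Subtype.ext (Fin.cons_self_tail c)
  right_inv c := by
    exact Sigma.subtype_ext (Subtype.ext c.2.2.2) rfl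

theorem card_chains_from {r : α → α → Prop} (hr : ∀ a b c, r a b → r b c → r a c) (k : ℕ) :
    ∀ a : α, Nat.card {c : Fin (k + 1) → α // (∀ i j, i < j → r (c i) (c j)) ∧ c 0 = a} =
      chainsFrom r k a := by
  induction k with
  | zero =>
    intro a
    rw [chainsFrom, Nat.card_eq_one_iff_unique]
    refine ⟨⟨fun c d => Subtype.ext (funext fun i => ?_)⟩, ⟨fun _ => a, fun i j h => ?_, rfl⟩⟩
    · rw [Subsingleton.elim (α := Fin 1) i 0, c.2.2, d.2.2]
    · exact absurd h (by simp [Subsingleton.elim (α := Fin 1) i j])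
  | succ k ih =>
    intro a
    rw [Nat.card_congr (chainEquiv hr k a), Nat.card_sigma, chainsFrom]
    simp only [ih]
    exact (Finset.sum_subtype _ (by simp) _).symm

theorem card_chains {r : α → α → Prop} (hr : ∀ a b c, r a b → r b c → r a c) (k : ℕ) :
    Nat.card {c : Fin (k + 1) → α // ∀ i j, i < j → r (c i) (c j)} = ∑ a, chainsFrom r k a := by
  simp only [← card_chains_from hr]
  rw [← Nat.card_sigma]
  exact Nat.card_congr
    { toFun := fun c => ⟨c.1 0, c.1, c.2, rfl⟩
      invFun := fun c => ⟨c.2.1, c.2.2.1⟩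
      left_inv := fun _ => rfl
      right_inv := fun ⟨_, _, _, h⟩ => by subst h; rfl }

/-- The number of chains from a point only depends on the isomorphism type of the set of
points above it. -/
theorem chainsFrom_eq_of_bijOn {r : α → α → Prop} {r' : β → β → Prop} {f : α → β} {U : Set α}
    {V : Set β} (hf : Set.BijOn f U V) (hU : ∀ a ∈ U, ∀ b, r a b → b ∈ U)
    (hV : ∀ a ∈ V, ∀ b, r' a b → b ∈ V)
    (hr : ∀ a ∈ U, ∀ b ∈ U, r a b ↔ r' (f a) (f b)) (k : ℕ) :
    ∀ a ∈ U, chainsFrom r k a = chainsFrom r' k (f a) := by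
  induction k with
  | zero => intro _ _; rfl
  | succ k ih =>
    intro a ha
    rw [chainsFrom, chainsFrom]
    refine Finset.sum_bij (fun b _ => f b) ?_ ?_ ?_ ?_
    · intro b hb
      simp only [Finset.mem_filter, Finset.mem_univ, true_and] at hb ⊢
      exact (hr a ha b (hU a ha b hb)).1 hb
    · intro b hb b' hb' h
      simp only [Finset.mem_filter, Finset.mem_univ, true_and] at hb hb'
      exact hf.injOn (hU a ha b hb) (hU a ha b' hb') h
    · intro b hb
      simp only [Finset.mem_filter, Finset.mem_univ, true_and] at hb
      obtain ⟨b', hb', rfl⟩ := hf.surjOn (hV _ (hf.mapsTo ha) b hb)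
      exact ⟨b', by simpa using (hr a ha b' hb').2 hb, rfl⟩
    · intro b hb
      simp only [Finset.mem_filter, Finset.mem_univ, true_and] at hb
      exact ih b (hU a ha b hb)

end Chains

section ShardChains

open Subgroup

/-- The strict shard order, reversed. -/
def shardGT (u v : W) : Prop := shardLE cs v u ∧ v ≠ u

variable {cs}

theorem shardGT_trans {u v w : W} (h₁ : shardGT cs u v) (h₂ : shardGT cs v w) :
    shardGT cs u w :=
  ⟨shardLE_trans h₂.1 h₁.1, fun h => by subst h; exact h₁.2 (shardLE_antisymm h₁.1 h₂.1)⟩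

variable [Fintype W]

theorem chainsFrom_shardGT (k : ℕ) (v : W) :
    chainsFrom (shardGT cs) k v = chainsFrom (shardGT cs) k (longest (des_subset cs v)) := by
  rw [← shardProj_self]
  have hV : ∀ w, w ∈ closure (des cs v) ↔ shardLE cs w (longest (des_subset cs v)) :=
    fun w => (shardLE_longest_iff _).symm
  refine chainsFrom_eq_of_bijOn (U := {u | shardLE cs u v}) (V := closure (des cs v))
    ⟨fun u _ => shardProj_mem v u, shardProj_injOn v, fun w hw => exists_shardProj_eq hw⟩
    (fun a ha b hb => shardLE_trans hb.1 ha) (fun a ha b hb => ?_) (fun a ha b hb => ?_) k v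
    (shardLE_refl cs v)
  · rw [SetLike.mem_coe, hV] at ha ⊢
    exact shardLE_trans hb.1 ha
  · refine and_congr ⟨shardProj_mono hb ha, shardLE_of_shardProj hb ha⟩ (not_congr ?_)
    exact ((shardProj_injOn v).eq_iff hb ha).symm

theorem chainsFrom_shardGT_succ (k : ℕ) {I : Set W} (hI : I ⊆ Set.range cs.simple) :
    chainsFrom (shardGT cs) (k + 1) (longest hI) + chainsFrom (shardGT cs) k (longest hI) =
      ∑ w with w ∈ closure I, chainsFrom (shardGT cs) k (longest (des_subset cs w)) := by
  simp only [← chainsFrom_shardGT]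
  rw [chainsFrom]
  have : Finset.univ.filter (fun w => w ∈ closure I) =
      insert (longest hI) (Finset.univ.filter (shardGT cs (longest hI))) := by
    ext w
    simp only [Finset.mem_filter, Finset.mem_univ, true_and, Finset.mem_insert, shardGT,
      shardLE_longest_iff]
    by_cases h : w = longest hI
    · subst h
      simp [longest_mem hI]
    · simp [h]
  rw [this, Finset.sum_insert (by simp [shardGT]), add_comm]

end ShardChains

/-! ### The BHZ order -/

section BHZ

open Subgroup

/-- The support of `w`, as a set of elements of `W`. -/
def sup (w : W) : Set W := cs.simple '' supp cs w

variable {cs}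

theorem sup_subset (w : W) : sup cs w ⊆ Set.range cs.simple := Set.image_subset_range _ _

theorem simple_mem_of_wordProd_mem_closure {I : Set W} (hI : I ⊆ Set.range cs.simple) (ω : List B) :
    cs.IsReduced ω → cs.wordProd ω ∈ closure I → ∀ i ∈ ω, cs.simple i ∈ I := by
  induction ω with
  | nil => simp
  | cons i ω ih =>
    intro hω hmem
    have hω' : cs.IsReduced ω := by simpa using hω.drop 1
    have hi : cs.simple i ∈ invSet cs (cs.wordProd (i :: ω)) := by
      refine ⟨cs.isReflection_simple i, ?_⟩
      rw [cs.wordProd_cons, cs.simple_mul_simple_cancel_left, ← cs.wordProd_cons, hω.eq, hω'.eq]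
      simp
    have hiI : cs.simple i ∈ I :=
      mem_of_simple_of_mem_closure cs hI ⟨i, rfl⟩ (invSet_subset_closure cs hI hmem hi)
    rw [cs.wordProd_cons, mul_mem_cancel_left (subset_closure hiI)] at hmem
    intro j hj
    rcases List.mem_cons.1 hj with rfl | hj
    · exact hiI
    · exact ih hω' hmem j hj

theorem mem_closure_iff_sup_subset {I : Set W} (hI : I ⊆ Set.range cs.simple) {w : W} :
    w ∈ closure I ↔ sup cs w ⊆ I := by
  constructor
  · rintro hw _ ⟨i, ⟨l, hl, rfl, hi⟩, rfl⟩
    exact simple_mem_of_wordProd_mem_closure hI l hl hw i hi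
  · intro h
    obtain ⟨l, hl, rfl⟩ := cs.exists_isReduced w
    refine _root_.list_prod_mem fun s hs => ?_
    obtain ⟨i, hi, rfl⟩ := List.mem_map.1 hs
    exact subset_closure (h ⟨i, ⟨l, hl, rfl, hi⟩, rfl⟩)

variable (cs) in
theorem mem_closure_sup (w : W) : w ∈ closure (sup cs w) :=
  (mem_closure_iff_sup_subset (sup_subset w)).2 subset_rfl

theorem sup_mul {x u : W} (h : cs.length (x * u) = cs.length x + cs.length u) :
    sup cs (x * u) = sup cs x ∪ sup cs u := by
  apply Set.Subset.antisymm
  · rw [← mem_closure_iff_sup_subset (Set.union_subset (sup_subset x) (sup_subset u))]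
    exact mul_mem (closure_mono Set.subset_union_left (mem_closure_sup cs x))
      (closure_mono Set.subset_union_right (mem_closure_sup cs u))
  · have key : ∀ l l', cs.IsReduced l → cs.IsReduced l' → cs.wordProd l = x →
        cs.wordProd l' = u → cs.IsReduced (l ++ l') ∧ cs.wordProd (l ++ l') = x * u := by
      rintro l l' hl hl' rfl rfl
      refine ⟨?_, cs.wordProd_append l l'⟩
      rw [CoxeterSystem.IsReduced, cs.wordProd_append, h, hl.eq, hl'.eq, List.length_append]
    rintro _ (⟨i, ⟨l, hl, hlx, hi⟩, rfl⟩ | ⟨i, ⟨l, hl, hlx, hi⟩, rfl⟩)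
    · obtain ⟨l', hl', hu⟩ := cs.exists_isReduced u
      have := key l l' hl hl' hlx hu.symm
      exact ⟨i, ⟨_, this.1, this.2, List.mem_append_left _ hi⟩, rfl⟩
    · obtain ⟨l', hl', hx⟩ := cs.exists_isReduced x
      have := key l' l hl' hl hx.symm hlx
      exact ⟨i, ⟨_, this.1, this.2, List.mem_append_right _ hi⟩, rfl⟩

theorem bhzLE_iff {u v : W} : bhzLE cs u v ↔ v * u⁻¹ ∈ minReps cs (sup cs u) := by
  have h1 : IsMinRep cs (supp cs u) (v * u⁻¹) ↔ v * u⁻¹ ∈ minReps cs (sup cs u) := by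
    constructor
    · rintro h _ ⟨i, hi, rfl⟩ hd
      exact h i hi hd.2
    · intro h i hi hd
      exact h _ ⟨i, hi, rfl⟩ ⟨⟨i, rfl⟩, hd⟩
  rw [← h1]
  refine ⟨fun h => h.2.1, fun h => ⟨mem_closure_sup cs u, h, ?_⟩⟩
  have := length_minRep_mul cs (sup_subset u) (h1.1 h) (mem_closure_sup cs u)
  rwa [inv_mul_cancel_right] at this

theorem bhzLE_antisymm {u v : W} (h₁ : bhzLE cs u v) (h₂ : bhzLE cs v u) : u = v := by
  have h1 := h₁.2.2
  have h2 := h₂.2.2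
  have : cs.length (v * u⁻¹) = 0 := by omega
  rw [cs.length_eq_zero_iff, mul_inv_eq_one] at this
  exact this.symm

theorem sup_eq_of_bhzLE {u v : W} (h : bhzLE cs u v) : sup cs v = sup cs (v * u⁻¹) ∪ sup cs u := by
  rw [← sup_mul, inv_mul_cancel_right]
  rw [inv_mul_cancel_right]
  exact h.2.2

theorem bhzLE_trans {u v w : W} (h₁ : bhzLE cs u v) (h₂ : bhzLE cs v w) : bhzLE cs u w := by
  have hs := sup_eq_of_bhzLE h₁
  rw [bhzLE_iff] at h₁ h₂ ⊢
  intro s hsu hsd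
  apply h₁ s hsu
  have e : w * u⁻¹ = w * v⁻¹ * (v * u⁻¹) := by group
  rw [e, mem_des_minRep_mul cs (sup_subset v) h₂ ?_ (hs ▸ Or.inr hsu)] at hsd
  · exact hsd
  · rw [mem_closure_iff_sup_subset (sup_subset v), hs]
    exact Set.subset_union_left

variable (cs) in
/-- The strict BHZ order. -/
def bhzLT (u v : W) : Prop := bhzLE cs u v ∧ u ≠ v

theorem bhzLT_trans {u v w : W} (h₁ : bhzLT cs u v) (h₂ : bhzLT cs v w) : bhzLT cs u w :=
  ⟨bhzLE_trans h₁.1 h₂.1, fun h => by subst h; exact h₁.2 (bhzLE_antisymm h₁.1 h₂.1)⟩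

variable (cs) in
theorem sup_one : sup cs (1 : W) = ∅ :=
  Set.subset_empty_iff.1 ((mem_closure_iff_sup_subset (Set.empty_subset _)).1 (one_mem _))

theorem one_mem_minReps (I : Set W) : (1 : W) ∈ minReps cs I := by
  intro s _ hs
  simpa using hs.2

variable [Fintype W]

variable (cs) in
/-- The number of chains of the BHZ order starting at an element of support `I`. -/
noncomputable def suppChains : ℕ → Set W → ℕ
  | 0, _ => 1
  | k + 1, I => ∑ x with x ∈ minReps cs I ∧ x ≠ 1, suppChains k (sup cs x ∪ I)

theorem chainsFrom_bhzLT (k : ℕ) :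
    ∀ u : W, chainsFrom (bhzLT cs) k u = suppChains cs k (sup cs u) := by
  induction k with
  | zero => intro _; rfl
  | succ k ih =>
    intro u
    rw [chainsFrom, suppChains]
    refine Finset.sum_bij (fun v _ => v * u⁻¹) ?_ ?_ ?_ ?_
    · intro v hv
      simp only [Finset.mem_filter, Finset.mem_univ, true_and] at hv ⊢
      exact ⟨bhzLE_iff.1 hv.1, fun h => hv.2 (mul_inv_eq_one.1 h).symm⟩
    · intro v _ v' _ h
      exact mul_right_cancel h
    · intro x hx
      simp only [Finset.mem_filter, Finset.mem_univ, true_and] at hx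
      refine ⟨x * u, ?_, mul_inv_cancel_right x u⟩
      simp only [Finset.mem_filter, Finset.mem_univ, true_and]
      refine ⟨?_, fun h => hx.2 (mul_eq_right.1 h.symm)⟩
      rw [bhzLE_iff, mul_inv_cancel_right]
      exact hx.1
    · intro v hv
      simp only [Finset.mem_filter, Finset.mem_univ, true_and] at hv
      rw [ih, sup_eq_of_bhzLE hv.1]

theorem suppChains_succ (k : ℕ) (I : Set W) : suppChains cs (k + 1) I + suppChains cs k I =
    ∑ x with x ∈ minReps cs I, suppChains cs k (sup cs x ∪ I) := by
  rw [suppChains]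
  have : Finset.univ.filter (fun x => x ∈ minReps cs I) =
      insert 1 (Finset.univ.filter fun x => x ∈ minReps cs I ∧ x ≠ 1) := by
    ext x
    by_cases h : x = 1
    · simp [h, one_mem_minReps]
    · simp [h]
  rw [this, Finset.sum_insert (by simp), sup_one, Set.empty_union, add_comm]

end BHZ

/-! ### The comparison -/

section Comparison

open Subgroup

variable [Fintype W]

/-- `supMatrix I J` is the number of `x ∈ W^I` with `S(x) ∪ I = J`. -/
noncomputable def supMatrix : Matrix (Set W) (Set W) ℤ := fun I J =>
  ∑ x with x ∈ minReps cs I, if J = sup cs x ∪ I then 1 else 0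

/-- `desMatrix K L` is the number of `w ∈ W_L` with `D_R(w) = K`, if `L ⊆ S`. -/
noncomputable def desMatrix : Matrix (Set W) (Set W) ℤ := fun K L =>
  ∑ w with w ∈ closure L ∧ L ⊆ Set.range cs.simple, if K = des cs w then 1 else 0

/-- The zeta matrix of the Boolean lattice of sets of simple reflections. -/
noncomputable def zetaMatrix : Matrix (Set W) (Set W) ℤ := fun I J =>
  if I ⊆ J ∧ J ⊆ Set.range cs.simple then 1 else 0

variable {cs}

theorem sum_supMatrix_mul (I : Set W) (f : Set W → ℤ) :
    ∑ J, supMatrix cs I J * f J = ∑ x with x ∈ minReps cs I, f (sup cs x ∪ I) := by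
  simp only [supMatrix, Finset.sum_mul]
  rw [Finset.sum_comm]
  simp

theorem sum_mul_desMatrix (L : Set W) (f : Set W → ℤ) :
    ∑ K, f K * desMatrix cs K L =
      ∑ w with w ∈ closure L ∧ L ⊆ Set.range cs.simple, f (des cs w) := by
  simp only [desMatrix, Finset.mul_sum]
  rw [Finset.sum_comm]
  simp

theorem card_minReps_eq_card_des {I L : Set W} (hI : I ⊆ Set.range cs.simple)
    (hL : L ⊆ Set.range cs.simple) :
    Finset.card {x | x ∈ minReps cs I ∧ sup cs x ∪ I ⊆ L} =
      Finset.card {w | w ∈ closure L ∧ I ⊆ des cs w} := by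
  refine Finset.card_bij' (fun x _ => x * longest hI) (fun w _ => w * longest hI) ?_ ?_
    (fun x _ => mul_longest_mul_longest hI x) (fun x _ => mul_longest_mul_longest hI x)
  · intro x hx
    simp only [Finset.mem_filter, Finset.mem_univ, true_and, Set.union_subset_iff] at hx ⊢
    exact ⟨mul_mem ((mem_closure_iff_sup_subset hL).2 hx.2.1)
      (closure_mono hx.2.2 (longest_mem hI)), subset_des_mul_longest hI hx.1⟩
  · intro w hw
    simp only [Finset.mem_filter, Finset.mem_univ, true_and, Set.union_subset_iff] at hw ⊢
    have hIL := hw.2.trans (des_subset_of_mem_closure hL hw.1)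
    exact ⟨mul_longest_mem_minReps hI hw.2, (mem_closure_iff_sup_subset hL).1
      (mul_mem hw.1 (closure_mono hIL (longest_mem hI))), hIL⟩

theorem supMatrix_mul_zetaMatrix :
    supMatrix cs * zetaMatrix cs = zetaMatrix cs * desMatrix cs := by
  ext I L
  rw [Matrix.mul_apply, Matrix.mul_apply, sum_supMatrix_mul I fun J => zetaMatrix cs J L,
    sum_mul_desMatrix]
  simp only [zetaMatrix, Finset.sum_boole, Finset.filter_filter]
  by_cases hL : L ⊆ Set.range cs.simple
  · by_cases hI : I ⊆ Set.range cs.simple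
    · have := card_minReps_eq_card_des hI hL
      simp only [hL, and_true, des_subset]
      exact_mod_cast this
    · have h1 : ∀ x, ¬ sup cs x ∪ I ⊆ L := fun x h =>
        hI ((Set.subset_union_right.trans h).trans hL)
      have h2 : ∀ w, ¬ I ⊆ des cs w := fun w h => hI (h.trans (des_subset cs w))
      simp [h1, h2]
  · simp [hL]

variable (cs) in
/-- The matrices `(A - 1) ^ k * Z`, where `A` is `supMatrix` and `Z` is `zetaMatrix`. -/
noncomputable def chainMatrix (k : ℕ) : Matrix (Set W) (Set W) ℤ :=
  (supMatrix cs - 1) ^ k * zetaMatrix cs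

theorem chainMatrix_succ_left (k : ℕ) :
    chainMatrix cs (k + 1) + chainMatrix cs k = supMatrix cs * chainMatrix cs k := by
  rw [chainMatrix, chainMatrix, pow_succ']
  noncomm_ring

theorem chainMatrix_succ_right (k : ℕ) :
    chainMatrix cs (k + 1) + chainMatrix cs k = chainMatrix cs k * desMatrix cs := by
  rw [chainMatrix, chainMatrix, pow_succ, mul_assoc, mul_assoc _ (zetaMatrix cs),
    ← supMatrix_mul_zetaMatrix]
  noncomm_ring

theorem suppChains_eq_chainMatrix (k : ℕ) : ∀ I, I ⊆ Set.range cs.simple →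
    (suppChains cs k I : ℤ) = chainMatrix cs k I (Set.range cs.simple) := by
  induction k with
  | zero =>
    intro I hI
    simp [suppChains, chainMatrix, zetaMatrix, hI]
  | succ k ih =>
    intro I hI
    have h1 := suppChains_succ (cs := cs) k I
    have h2 := congrFun (congrFun (chainMatrix_succ_left (cs := cs) k) I) (Set.range cs.simple)
    rw [Matrix.add_apply, Matrix.mul_apply,
      sum_supMatrix_mul I fun J => chainMatrix cs k J (Set.range cs.simple)] at h2
    zify at h1
    rw [ih I hI, Finset.sum_congr rfl fun x _ => ih _ (Set.union_subset (sup_subset x) hI),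
      ← h2] at h1
    exact add_right_cancel h1

theorem chainsFrom_longest_eq_chainMatrix (k : ℕ) : ∀ (L : Set W) (hL : L ⊆ Set.range cs.simple),
    (chainsFrom (shardGT cs) k (longest hL) : ℤ) = chainMatrix cs k ∅ L := by
  induction k with
  | zero =>
    intro L hL
    simp [chainsFrom, chainMatrix, zetaMatrix, hL]
  | succ k ih =>
    intro L hL
    have h1 := chainsFrom_shardGT_succ k hL
    have h2 := congrFun (congrFun (chainMatrix_succ_right (cs := cs) k) ∅) L
    rw [Matrix.add_apply, Matrix.mul_apply, sum_mul_desMatrix] at h2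
    simp only [hL, and_true] at h2
    zify at h1
    rw [ih L hL, Finset.sum_congr rfl fun w _ => ih _ (des_subset cs w), ← h2] at h1
    exact add_right_cancel h1

theorem sum_chainsFrom_eq (k : ℕ) :
    ∑ v, chainsFrom (shardGT cs) k v = ∑ u, chainsFrom (bhzLT cs) k u := by
  have hS := subset_rfl (a := Set.range cs.simple)
  have key : ∀ k, chainsFrom (shardGT cs) k (longest hS) = suppChains cs k ∅ := by
    intro k
    zify
    rw [chainsFrom_longest_eq_chainMatrix, suppChains_eq_chainMatrix k _ (Set.empty_subset _)]
  have h1 := chainsFrom_shardGT_succ k hS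
  have h2 := suppChains_succ (cs := cs) k ∅
  simp only [cs.subgroup_closure_range_simple, mem_top, Finset.filter_true,
    ← chainsFrom_shardGT] at h1
  have h3 : ∀ x : W, x ∈ minReps cs ∅ := fun _ _ h => absurd h (Set.notMem_empty _)
  simp only [h3, Finset.filter_true, Set.union_empty, ← chainsFrom_bhzLT] at h2
  rw [← h1, ← h2, key, key]

end Comparison


/-- For every `k ≥ 1`, the number of strict `k`-chains in the shard order equals the
number of strict `k`-chains in the BHZ order (i.e. the `f`-vectors of the two order
complexes coincide). -/
theorem strict_chains_card_eq [Finite W] (k : ℕ) (hk : 1 ≤ k) :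
    Nat.card {c : Fin k → W // ∀ i j : Fin k, i < j → shardLE cs (c i) (c j) ∧ c i ≠ c j} =
      Nat.card {c : Fin k → W // ∀ i j : Fin k, i < j → bhzLE cs (c i) (c j) ∧ c i ≠ c j} := by
  obtain ⟨k, rfl⟩ := Nat.exists_eq_add_of_le' hk
  cases nonempty_fintype W
  rw [card_chains_swap fun u v => shardLE cs u v ∧ u ≠ v]
  exact ((card_chains (r := shardGT cs) (fun _ _ _ => shardGT_trans) k).trans
    (sum_chainsFrom_eq k)).trans
    (card_chains (r := bhzLT cs) (fun _ _ _ => bhzLT_trans) k).symm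

end ShardBHZ
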